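/- arXiv:math/0407394 — 3 statements merged into one kernel-verified Lean document; each statement's English description precedes it below -/
import Mathlib

section
/- Let m ≥ 2 and let L be a thick generalized m-gon. Then for any two apartments A and A' of L there is a finite sequence of apartments A₀ = A, A₁, …, Aₙ = A' such that for every i with 0 ≤ i ≤ n−1 the intersection A_i ∩ A_{i+1} is a half apartment, i.e., a path in L with exactly m edges. -/
open SimpleGraph

variable {V : Type*}

/-- A generalized `m`-gon: a connected bipartite simple graph of diameter `m`
and girth `2 * m`. -/
def IsGenPolygon (G : SimpleGraph V) (m : ℕ) : Prop :=
  G.Connected ∧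
    (∃ c : V → Bool, ∀ ⦃v w : V⦄, G.Adj v w → c v ≠ c w) ∧
    (∀ u v : V, G.dist u v ≤ m) ∧ (∃ u v : V, G.dist u v = m) ∧
    G.egirth = (2 * m : ℕ∞)

/-- A graph is thick if every vertex has at least three neighbours. -/
def Thick (G : SimpleGraph V) : Prop :=
  ∀ v : V, ∃ a b c : V, G.Adj v a ∧ G.Adj v b ∧ G.Adj v c ∧ a ≠ b ∧ a ≠ c ∧ b ≠ c

/-- An apartment of a generalized `m`-gon: a subgraph which is a cycle of
length `2 * m`. -/
def IsApartment (G : SimpleGraph V) (m : ℕ) (A : G.Subgraph) : Prop :=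
  ∃ (v : V) (w : G.Walk v v), w.IsCycle ∧ w.length = 2 * m ∧ w.toSubgraph = A

/-- A subgraph which is a path with exactly `k` edges. -/
def IsPathSubgraph (G : SimpleGraph V) (k : ℕ) (P : G.Subgraph) : Prop :=
  ∃ (u v : V) (p : G.Walk u v), p.IsPath ∧ p.length = k ∧ p.toSubgraph = P

namespace GenPoly

variable {G : SimpleGraph V} {m : ℕ}

/-- Short paths with the same ends coincide. -/
lemma path_eq (hG : IsGenPolygon G m) {u v : V} {p q : G.Walk u v}
    (hp : p.IsPath) (hq : q.IsPath) (h : p.length + q.length < 2 * m) : p = q := by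
  by_contra hne
  obtain ⟨w, -, -, c, hc, hl⟩ := hp.exists_isCycle_length_le_add_of_ne hq hne
  have h1 := egirth_le_length hc
  rw [hG.2.2.2.2] at h1
  have h2 : 2 * m ≤ c.length := by exact_mod_cast h1
  omega

/-- Distinct half apartments with the same ends meet only in the ends. -/
lemma inter_ends (hG : IsGenPolygon G m) {u v x : V} {p q : G.Walk u v}
    (hp : p.IsPath) (hq : q.IsPath) (hpl : p.length = m) (hql : q.length = m) (hne : p ≠ q)
    (hxp : x ∈ p.support) (hxq : x ∈ q.support) : x = u ∨ x = v := by
  obtain ⟨p1, p2, rfl⟩ := Walk.mem_support_iff_exists_append.1 hxp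
  obtain ⟨q1, q2, rfl⟩ := Walk.mem_support_iff_exists_append.1 hxq
  by_contra hcon
  push Not at hcon
  have a1 : p1.length ≠ 0 := fun h => hcon.1 (Walk.eq_of_length_eq_zero h).symm
  have a2 : p2.length ≠ 0 := fun h => hcon.2 (Walk.eq_of_length_eq_zero h)
  rw [Walk.length_append] at hpl hql
  apply hne
  rw [path_eq hG hp.of_append_left hq.of_append_left (by omega),
    path_eq hG hp.of_append_right hq.of_append_right (by omega)]

lemma apartment_of (hm : 2 ≤ m) (hG : IsGenPolygon G m) {u v : V} {p q : G.Walk u v}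
    (hp : p.IsPath) (hq : q.IsPath) (hpl : p.length = m) (hql : q.length = m) (hne : p ≠ q) :
    IsApartment G m (p.toSubgraph ⊔ q.toSubgraph) := by
  refine ⟨u, p.append q.reverse, ?_, ?_, by simp⟩
  · refine hp.isCycle_append hq.reverse ?_ (Or.inl (by omega))
    intro x hx hx'
    have h1 : x ∈ p.support := List.mem_of_mem_tail hx
    have h2 : x ∈ q.support := by
      have := List.mem_of_mem_tail hx'
      simpa using this
    have n1 := hp.support_nodup
    have n2 := hq.reverse.support_nodup
    rw [← Walk.cons_tail_support] at n1 n2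
    rcases inter_ends hG hp hq hpl hql hne h1 h2 with rfl | rfl
    · exact (List.nodup_cons.1 n1).1 hx
    · exact (List.nodup_cons.1 n2).1 hx'
  · simp [hpl, hql]; omega

lemma of_apartment (hm : 2 ≤ m) {A : G.Subgraph} (hA : IsApartment G m A) :
    ∃ (u v : V) (p q : G.Walk u v), p.IsPath ∧ q.IsPath ∧ p.length = m ∧ q.length = m ∧ p ≠ q ∧
      A = p.toSubgraph ⊔ q.toSubgraph := by
  obtain ⟨v, c, hc, hl, rfl⟩ := hA
  have hs : (c.take m).append (c.drop m) = c := by simp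
  have l1 : (c.take m).length = m := by simp; omega
  have l2 : (c.drop m).length = m := by simp; omega
  refine ⟨_, _, c.take m, (c.drop m).reverse, hc.isPath_take (by omega),
    (hc.isPath_drop (by omega)).reverse, l1, by simp; omega, ?_, ?_⟩
  · intro h
    have ht := hc.isTrail
    rw [← hs] at ht
    have hd := ((Walk.isTrail_append _ _).1 ht).2.2
    obtain ⟨e, he⟩ := List.exists_mem_of_ne_nil (c.take m).edges (by
      intro h0
      have := congrArg List.length h0
      simp only [Walk.length_edges, l1] at this
      simp at this; omega)
    refine hd he ?_
    rw [h] at he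
    simpa using he
  · rw [Walk.toSubgraph_reverse, ← Walk.toSubgraph_append, hs]

lemma inf_eq (hG : IsGenPolygon G m) {u v : V} {p q r : G.Walk u v}
    (hp : p.IsPath) (hq : q.IsPath) (hr : r.IsPath)
    (hpl : p.length = m) (hql : q.length = m) (hrl : r.length = m) (hm : 2 ≤ m)
    (hqr : q ≠ r) :
    (p.toSubgraph ⊔ q.toSubgraph) ⊓ (p.toSubgraph ⊔ r.toSubgraph) = p.toSubgraph := by
  rw [← sup_inf_left, sup_eq_left]
  constructor
  · intro x hx
    simp only [Subgraph.verts_inf, Walk.verts_toSubgraph, Set.mem_inter_iff, Set.mem_setOf_eq]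
      at hx ⊢
    rcases inter_ends hG hq hr hql hrl hqr hx.1 hx.2 with rfl | rfl <;> simp
  · intro x y hxy
    exfalso
    have hne := hxy.adj_sub.ne
    rw [Subgraph.inf_adj] at hxy
    have e1 := (q.mem_verts_toSubgraph).1 hxy.1.fst_mem
    have e2 := (r.mem_verts_toSubgraph).1 hxy.2.fst_mem
    have e3 := (q.mem_verts_toSubgraph).1 hxy.1.snd_mem
    have e4 := (r.mem_verts_toSubgraph).1 hxy.2.snd_mem
    have key : ∀ h : G.Adj u v, False := by
      intro h
      have := path_eq hG (p := Walk.cons h Walk.nil) (q := q) (by simp [h.ne]) hq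
        (by simp; omega)
      rw [← this] at hql
      simp at hql; omega
    have hadj := hxy.1.adj_sub
    rcases inter_ends hG hq hr hql hrl hqr e1 e2 with rfl | rfl <;>
    rcases inter_ends hG hq hr hql hrl hqr e3 e4 with rfl | rfl
    · exact hne rfl
    · exact key hadj
    · exact key hadj.symm
    · exact hne rfl

/-- One elementary move. -/
def Move (G : SimpleGraph V) (m : ℕ) (A B : G.Subgraph) : Prop :=
  IsApartment G m A ∧ IsApartment G m B ∧ IsPathSubgraph G m (A ⊓ B)

lemma move (hm : 2 ≤ m) (hG : IsGenPolygon G m) {u v : V} {p q r : G.Walk u v}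
    (hp : p.IsPath) (hq : q.IsPath) (hr : r.IsPath)
    (hpl : p.length = m) (hql : q.length = m) (hrl : r.length = m)
    (hpq : p ≠ q) (hpr : p ≠ r) :
    Relation.ReflTransGen (Move G m) (p.toSubgraph ⊔ q.toSubgraph)
      (p.toSubgraph ⊔ r.toSubgraph) := by
  by_cases hqr : q = r
  · subst hqr; exact .refl
  · exact .single ⟨apartment_of hm hG hp hq hpl hql hpq, apartment_of hm hG hp hr hpl hrl hpr,
      u, v, p, hp, hpl, (inf_eq hG hp hq hr hpl hql hrl hm hqr).symm⟩

/-- A half apartment leaving `x` in a direction outside `p`. -/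
lemma exists_half (hG : IsGenPolygon G m) {x x' w : V} {p : G.Walk x w}
    (hp : p.IsPath) (hpl : p.length = m) (h : G.Adj x x') (hx' : x' ∉ p.support) :
    ∃ q : G.Walk x' w, (Walk.cons h q).IsPath ∧ (Walk.cons h q).length = m := by
  obtain ⟨q, hq, hql⟩ := hG.1.exists_path_of_dist x' w
  have hd := hG.2.2.1 x' w
  obtain ⟨c, hc⟩ := hG.2.1
  let C : G.Coloring Bool := Coloring.mk c (fun {_ _} h => hc h)
  have c1 := C.even_length_iff_congr p
  have c2 := C.even_length_iff_congr q
  have c3 : C x ≠ C x' := hc h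
  have hlt : q.length + 1 ≤ m := by
    by_contra hcon
    have : q.length = p.length := by omega
    rw [this, c1] at c2
    revert c2 c3
    cases C x <;> cases C x' <;> cases C w <;> simp
  have hxq : x ∉ q.support := by
    intro hx
    obtain ⟨q1, q2, rfl⟩ := Walk.mem_support_iff_exists_append.1 hx
    rw [Walk.length_append] at hlt
    have := path_eq hG hp hq.of_append_right (by omega)
    rw [this] at hpl
    omega
  have hcons : (Walk.cons h q).IsPath := hq.cons hxq
  refine ⟨q, hcons, ?_⟩
  by_contra hne
  rw [Walk.length_cons] at hne
  have := path_eq hG hp hcons (by rw [Walk.length_cons]; omega)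
  apply hx'
  rw [this]
  simp

/-- Shifting an apartment along one edge. -/
lemma step (hm : 2 ≤ m) (hG : IsGenPolygon G m) {x x' y w : V} (p : G.Walk x y) (r : G.Walk y w)
    (H' : G.Walk x w) (hH : (p.append r).IsPath) (hHl : (p.append r).length = m)
    (hH' : H'.IsPath) (hHl' : H'.length = m) (hne : p.append r ≠ H')
    (h : G.Adj x' x) (hx' : x' ∉ (p.append r).support) (hr : r.length ≠ 0) :
    ∃ (w₁ : V) (s : G.Walk y w₁) (K' : G.Walk x' w₁),
      ((Walk.cons h p).append s).IsPath ∧ ((Walk.cons h p).append s).length = m ∧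
      K'.IsPath ∧ K'.length = m ∧ (Walk.cons h p).append s ≠ K' ∧
      Relation.ReflTransGen (Move G m) ((p.append r).toSubgraph ⊔ H'.toSubgraph)
        (((Walk.cons h p).append s).toSubgraph ⊔ K'.toSubgraph) := by
  obtain ⟨q, hq, hql⟩ := exists_half hG hH hHl h.symm hx'
  have hHq : p.append r ≠ Walk.cons h.symm q := by
    intro e; apply hx'; rw [e]; simp
  have hmove := move hm hG hH hH' hq hHl hHl' hql hne hHq
  obtain ⟨w₁, s, hw, rfl⟩ : ∃ (w₁ : V) (s : G.Walk y w₁) (hw : G.Adj w₁ w), r = s.concat hw := by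
    cases r with
    | nil => simp at hr
    | cons a b =>
      obtain ⟨z, s, hw, e⟩ := Walk.exists_cons_eq_concat a b
      exact ⟨z, s, hw, e⟩
  have hcc : p.append (s.concat hw) = (p.append s).concat hw := by
    rw [Walk.append_concat]
  have hw1 : w₁ ∈ (p.append (s.concat hw)).support := by simp
  rw [hcc] at hH hHl hx'
  obtain ⟨hps, hwps⟩ := (Walk.concat_isPath_iff hw).1 hH
  obtain ⟨hq1, hxq⟩ := (Walk.cons_isPath_iff _ _).1 hq
  rw [Walk.length_concat] at hHl
  rw [Walk.length_cons] at hql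
  have hxw : x ≠ w := by
    rintro rfl; apply hwps; simp
  have hK : ((Walk.cons h p).append s).IsPath := by
    rw [Walk.cons_append]
    refine hps.cons fun hx => hx' ?_
    rw [Walk.support_concat]
    simp [hx]
  have hK' : (q.concat hw.symm).IsPath := by
    refine hq1.concat (fun hwq => ?_) _
    rw [← hcc] at hH
    rcases inter_ends hG hH hq (by rw [hcc, Walk.length_concat]; exact hHl)
      (by rw [Walk.length_cons]; exact hql) hHq hw1 (by simp [hwq]) with e | e
    · subst e
      exact hxq hwq
    · exact hw.ne e
  refine ⟨w₁, s, q.concat hw.symm, hK, by simp at hHl ⊢; omega, hK', by simpa using hql, ?_, ?_⟩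
  · intro e
    have hx : x ∈ ((Walk.cons h p).append s).support := by simp
    rw [e, Walk.support_concat] at hx
    simp only [List.concat_eq_append, List.mem_append, List.mem_singleton] at hx
    rcases hx with hx | hx
    · exact hxq hx
    · subst hx
      have := hps
      rw [Walk.isPath_iff_eq_nil] at this
      rw [this] at hHl
      simp at hHl; omega
  · convert hmove using 1
    have s1 : G.subgraphOfAdj hw.symm = G.subgraphOfAdj hw := subgraphOfAdj_symm hw
    have s2 : G.subgraphOfAdj h.symm = G.subgraphOfAdj h := subgraphOfAdj_symm h
    have t : ∀ {a b c : V} (k : G.Walk a b) (hk : G.Adj b c),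
        (k.concat hk).toSubgraph = k.toSubgraph ⊔ G.subgraphOfAdj hk := by
      intro a b c k hk
      rw [Walk.concat_eq_append, Walk.toSubgraph_append, Walk.toSubgraph_cons_nil_eq_subgraphOfAdj]
    rw [Walk.toSubgraph_append, Walk.toSubgraph_append, t, t]
    simp only [Walk.toSubgraph]
    rw [s1, s2]
    ac_rfl

/-- `A` can be moved to an apartment through `x`. -/
def At (G : SimpleGraph V) (m : ℕ) (A : G.Subgraph) (x : V) : Prop :=
  ∃ (w : V) (H H' : G.Walk x w), H.IsPath ∧ H.length = m ∧ H'.IsPath ∧ H'.length = m ∧ H ≠ H' ∧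
    Relation.ReflTransGen (Move G m) A (H.toSubgraph ⊔ H'.toSubgraph)

lemma At.out (hm : 2 ≤ m) (hG : IsGenPolygon G m) {A : G.Subgraph} {x x' : V}
    (hA : At G m A x) (h : G.Adj x' x) :
    ∃ (w : V) (H H' : G.Walk x w), H.IsPath ∧ H.length = m ∧ H'.IsPath ∧ H'.length = m ∧ H ≠ H' ∧
    x' ∉ H.support ∧
    Relation.ReflTransGen (Move G m) A (H.toSubgraph ⊔ H'.toSubgraph) := by
  obtain ⟨w, H, H', h1, h2, h3, h4, h5, h6⟩ := hA
  by_cases a : x' ∈ H.support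
  · by_cases b : x' ∈ H'.support
    · exfalso
      rcases inter_ends hG h1 h3 h2 h4 h5 a b with rfl | rfl
      · exact h.ne rfl
      · have := path_eq hG (p := Walk.cons h.symm Walk.nil) (q := H) (by simp [h.symm.ne]) h1
          (by simp; omega)
        rw [← this] at h2
        simp at h2; omega
    · exact ⟨w, H', H, h3, h4, h1, h2, h5.symm, b, by rwa [sup_comm]⟩
  · exact ⟨w, H, H', h1, h2, h3, h4, h5, a, h6⟩

lemma At.adj (hm : 2 ≤ m) (hG : IsGenPolygon G m) {A : G.Subgraph} {x x' : V}
    (hA : At G m A x) (h : G.Adj x' x) : At G m A x' := by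
  obtain ⟨w, H, H', h1, h2, h3, h4, h5, a, h6⟩ := hA.out hm hG h
  obtain ⟨w₁, s, K', k1, k2, k3, k4, k5, k6⟩ := step hm hG Walk.nil H H' h1 h2 h3 h4 h5 h a
    (by omega)
  exact ⟨w₁, _, K', k1, k2, k3, k4, k5, h6.trans k6⟩

lemma At.walk (hm : 2 ≤ m) (hG : IsGenPolygon G m) {A : G.Subgraph} {x y : V}
    (p : G.Walk x y) (hA : At G m A y) : At G m A x := by
  induction p with
  | nil => exact hA
  | cons h p ih => exact (ih hA).adj hm hG h

lemma along (hm : 2 ≤ m) (hG : IsGenPolygon G m) {A : G.Subgraph} {x y : V}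
    (p : G.Walk x y) (hA : At G m A y) (hp : p.IsPath) (hpl : p.length ≤ m) :
    ∃ (w : V) (r : G.Walk y w) (H' : G.Walk x w), (p.append r).IsPath ∧ (p.append r).length = m ∧
      H'.IsPath ∧ H'.length = m ∧ p.append r ≠ H' ∧
      Relation.ReflTransGen (Move G m) A ((p.append r).toSubgraph ⊔ H'.toSubgraph) := by
  induction p with
  | nil =>
    obtain ⟨w, H, H', h⟩ := hA
    exact ⟨w, H, H', h⟩
  | @cons x' x y h p ih =>
    rw [Walk.length_cons] at hpl
    obtain ⟨hp1, hxp⟩ := (Walk.cons_isPath_iff _ _).1 hp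
    cases p with
    | nil =>
      obtain ⟨w, H, H', h1, h2, h3, h4, h5, a, h6⟩ := hA.out hm hG h
      obtain ⟨w₁, s, K', k1, k2, k3, k4, k5, k6⟩ := step hm hG Walk.nil H H' h1 h2 h3 h4 h5 h a
        (by omega)
      exact ⟨w₁, s, K', k1, k2, k3, k4, k5, h6.trans k6⟩
    | @cons _ z _ h' p =>
      obtain ⟨w, r, H', h1, h2, h3, h4, h5, h6⟩ := ih hA hp1 (by omega)
      have hr : r.length ≠ 0 := by
        rw [Walk.length_append] at h2
        omega
      have a : x' ∉ ((Walk.cons h' p).append r).support := by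
        intro hx
        obtain ⟨q1, q2, e⟩ := Walk.mem_support_iff_exists_append.1 hx
        have h1' := h1
        have h2' := h2
        rw [e] at h1' h2'
        have hq2 : q2.length ≠ 0 ∨ q2.length = 0 := by omega
        rw [Walk.length_append] at h2'
        have := path_eq hG (p := Walk.cons h.symm Walk.nil) (q := q1) (by simp [h.symm.ne])
          h1'.of_append_left (by simp; omega)
        subst this
        have e1 := congrArg Walk.snd e
        simp at e1
        apply hxp
        rw [← e1]
        simp
      obtain ⟨w₁, s, K', k1, k2, k3, k4, k5, k6⟩ := step hm hG _ r H' h1 h2 h3 h4 h5 h a hr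
      exact ⟨w₁, s, K', k1, k2, k3, k4, k5, h6.trans k6⟩

lemma reach (hm : 2 ≤ m) (hG : IsGenPolygon G m) {A B : G.Subgraph}
    (hA : IsApartment G m A) (hB : IsApartment G m B) :
    Relation.ReflTransGen (Move G m) A B := by
  obtain ⟨u, v, p, q, hp, hq, hpl, hql, hne, rfl⟩ := of_apartment hm hA
  obtain ⟨u', v', p', q', hp', hq', hpl', hql', hne', rfl⟩ := of_apartment hm hB
  have h0 : At G m (p.toSubgraph ⊔ q.toSubgraph) u :=
    ⟨v, p, q, hp, hpl, hq, hql, hne, .refl⟩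
  obtain ⟨t⟩ := hG.1.preconnected v' u
  obtain ⟨w, r, H', h1, h2, h3, h4, h5, h6⟩ := along hm hG p' (h0.walk hm hG t) hp' hpl'.le
  cases r with
  | nil =>
    rw [Walk.append_nil] at h5 h6
    exact h6.trans (move hm hG hp' h3 hq' hpl' h4 hql' h5 hne')
  | cons a b =>
    rw [Walk.length_append, Walk.length_cons] at h2
    omega

end GenPoly

/-- Any two apartments of a thick generalized `m`-gon are connected by a chain of
apartments in which consecutive apartments intersect in a half apartment
(a path with exactly `m` edges). -/
theorem apartments_connected_by_half_apartments
    (G : SimpleGraph V) (m : ℕ) (hm : 2 ≤ m)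
    (hG : IsGenPolygon G m) (hthick : Thick G)
    (A A' : G.Subgraph) (hA : IsApartment G m A) (hA' : IsApartment G m A') :
    ∃ (n : ℕ) (f : ℕ → G.Subgraph),
      f 0 = A ∧ f n = A' ∧
      (∀ i ≤ n, IsApartment G m (f i)) ∧
      (∀ i < n, IsPathSubgraph G m (f i ⊓ f (i + 1))) := by
  have h := GenPoly.reach hm hG hA hA'
  clear hA'
  induction h with
  | refl => exact ⟨0, fun _ => A, rfl, rfl, fun _ _ => hA, fun i hi => absurd hi (by omega)⟩
  | @tail B C _ hBC ih =>
    obtain ⟨n, f, f0, fn, h1, h2⟩ := ih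
    refine ⟨n + 1, fun i => if i ≤ n then f i else C, by simp [f0], by simp, ?_, ?_⟩
    · intro i _
      by_cases hi : i ≤ n
      · simpa [hi] using h1 i hi
      · simpa [hi] using hBC.2.1
    · intro i hi
      have hin : i ≤ n := by omega
      by_cases hi' : i + 1 ≤ n
      · simpa [hi', hin] using h2 i (by omega)
      · have : i = n := by omega
        subst this
        simpa [fn] using hBC.2.2
end

section
/- (Feit–Higman) Let m ≥ 2 and let L be a finite thick generalized m-gon. Then m ∈ {2, 3, 4, 6, 8}. -/
open SimpleGraph

variable {V : Type*}

/-- Scaled Chebyshev polynomials of the second kind. -/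
def uu {R : Type*} [Ring R] (N : ℕ) (x : R) : ℕ → R
  | 0 => 1
  | 1 => x
  | (k+2) => x * uu N x (k+1) - (N : R) * uu N x k

lemma uu_map {R S : Type*} [Ring R] [Ring S] (f : R →+* S) (N : ℕ) (x : R) (k : ℕ) :
    f (uu N x k) = uu N (f x) k := by
  induction k using Nat.twoStepInduction with
  | zero => simp [uu]
  | one => simp [uu]
  | more k h1 h2 => simp [uu, h1, h2]

lemma trace_idem {V : Type*} [Fintype V] [DecidableEq V] (E : Matrix V V ℝ) (hE : E * E = E) :
    ∃ μ : ℕ, E.trace = μ := by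
  have h : IsIdempotentElem (Matrix.toLin' E) := by
    unfold IsIdempotentElem
    rw [Module.End.mul_eq_comp, ← Matrix.toLin'_mul, hE]
  have := (LinearMap.isProj_range_iff_isIdempotentElem _).2 h
  exact ⟨_, by rw [← Matrix.trace_toLin'_eq, this.trace]⟩

open Polynomial in
lemma cd_identity (N : ℕ) (hN : 0 < N) (y : ℝ) (n : ℕ) :
    (X - C y) * ∑ k ∈ Finset.range (n+1), C (uu N y k / (N:ℝ)^k) * uu N (X : ℝ[X]) k =
      C (((N:ℝ)^n)⁻¹) * (uu N X (n+1) * C (uu N y n) - uu N X n * C (uu N y (n+1))) := by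
  have hN' : (N:ℝ) ≠ 0 := by positivity
  induction n with
  | zero => simp [uu]
  | succ n ih =>
    rw [Finset.sum_range_succ, mul_add, ih]
    have e1 : (C (((N:ℝ)^n)⁻¹) : ℝ[X]) = C (((N:ℝ)^(n+1))⁻¹) * (N : ℝ[X]) := by
      rw [← C_eq_natCast, ← C_mul]; congr 1; field_simp; ring
    have e2 : (C (uu N y (n+1) / (N:ℝ)^(n+1)) : ℝ[X]) = C (((N:ℝ)^(n+1))⁻¹) * C (uu N y (n+1)) := by
      rw [← C_mul]; congr 1; field_simp
    have e3 : uu N y (n+1+1) = y * uu N y (n+1) - (N:ℝ) * uu N y n := rfl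
    have e4 : uu N (X:ℝ[X]) (n+1+1) = X * uu N X (n+1) - (N:ℝ[X]) * uu N X n := rfl
    rw [e1, e2, e3, e4]
    simp only [C_sub, C_mul, C_eq_natCast]
    ring

open Polynomial in
lemma mult_int {V : Type*} [Fintype V] [DecidableEq V] (M : Matrix V V ℝ) (w : ℝ[X])
    (N n : ℕ) (hN : 0 < N) (y : ℝ)
    (hann : aeval M w * uu N M (n+1) = 0)
    (htr : ∀ k, 1 ≤ k → k ≤ n → (aeval M w * uu N M k).trace = 0)
    (hy : uu N y (n+1) = 0) (hw : w.eval y ≠ 0) :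
    ∃ μ : ℕ, μ * (w.eval y * ∑ k ∈ Finset.range (n+1), uu N y k ^ 2 / (N:ℝ)^k) =
      (aeval M w).trace := by
  set P : ℝ[X] := ∑ k ∈ Finset.range (n+1), C (uu N y k / (N:ℝ)^k) * uu N (X : ℝ[X]) k with hP
  have hmap : ∀ k, aeval M (uu N (X:ℝ[X]) k) = uu N M k := fun k => by
    have := uu_map (aeval M : ℝ[X] →ₐ[ℝ] _).toRingHom N X k
    simpa using this
  have heval : ∀ k, eval y (uu N (X:ℝ[X]) k) = uu N y k := fun k => by
    have := uu_map (evalRingHom y) N X k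
    simpa using this
  have hPy : P.eval y = ∑ k ∈ Finset.range (n+1), uu N y k ^ 2 / (N:ℝ)^k := by
    rw [hP, eval_finsetSum]
    refine Finset.sum_congr rfl fun k _ => ?_
    rw [eval_mul, eval_C, heval]; ring
  have hpos : 0 < P.eval y := by
    rw [hPy]
    refine Finset.sum_pos' (fun k _ => by positivity) ⟨0, by simp, by simp [uu]⟩
  set H := aeval M (w * P) with hH
  have hXH : aeval M ((X - C y) * (w * P)) = 0 := by
    have : (X - C y) * (w * P) = w * ((X - C y) * P) := by ring
    rw [this, hP, cd_identity N hN, hy]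
    have : w * (C (((N:ℝ)^n)⁻¹) * (uu N X (n+1) * C (uu N y n) - uu N X n * C 0)) =
      (w * uu N X (n+1)) * C (((N:ℝ)^n)⁻¹ * uu N y n) := by
      simp only [C_mul, C_0]; ring
    rw [this, map_mul, map_mul, hmap, hann, zero_mul]
  have hg : ∀ g : ℝ[X], aeval M (g * (w * P)) = g.eval y • H := by
    intro g
    obtain ⟨g2, hg2⟩ := X_sub_C_dvd_sub_C_eval (a := y) (p := g)
    have : g * (w * P) = g2 * ((X - C y) * (w * P)) + C (g.eval y) * (w * P) := by
      linear_combination (w * P) * hg2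
    rw [this, map_add, map_mul, hXH, map_mul, aeval_C, mul_zero, zero_add, ← Algebra.smul_def]
  have hHH : H * H = (w.eval y * P.eval y) • H := by
    have := hg (w * P)
    rw [map_mul, eval_mul] at this
    exact this
  have hne : w.eval y * P.eval y ≠ 0 := mul_ne_zero hw hpos.ne'
  obtain ⟨μ, hμ⟩ := trace_idem ((w.eval y * P.eval y)⁻¹ • H) (by
    rw [smul_mul_smul_comm, hHH, smul_smul]; congr 1; field_simp)
  refine ⟨μ, ?_⟩
  rw [← hμ, ← hPy, Matrix.trace_smul, smul_eq_mul, mul_comm, ← mul_assoc, mul_inv_cancel₀ hne, one_mul]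
  rw [hH, map_mul, hP, map_sum, Finset.mul_sum, Matrix.trace_sum, Finset.sum_eq_single 0]
  · simp [uu]
  · intro k hk hk0
    rw [map_mul, hmap, aeval_C, ← Algebra.smul_def, mul_smul_comm,
      Matrix.trace_smul, htr k (by omega) (by simpa [Nat.lt_succ_iff] using hk), smul_zero]
  · simp

/-- value at `2 √N cos θ`. -/
lemma uu_cos (N : ℕ) (θ : ℝ) (k : ℕ) :
    uu N (2 * √N * Real.cos θ) k * Real.sin θ = (√N)^k * Real.sin ((k+1) * θ) := by
  have hs : √(N:ℝ) * √N = N := Real.mul_self_sqrt (by positivity)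
  induction k using Nat.twoStepInduction with
  | zero => simp [uu]
  | one =>
    simp only [uu]; push_cast
    rw [show ((1:ℝ)+1) * θ = 2 * θ by ring, Real.sin_two_mul]; ring
  | more k h1 h2 =>
    have h3 : Real.sin ((k+2+1) * θ) = 2 * Real.cos θ * Real.sin ((k+1+1) * θ) - Real.sin ((k+1)*θ) := by
      rw [show ((k:ℝ)+2+1) * θ = (k+1+1) * θ + θ by ring, show ((k:ℝ)+1) * θ = (k+1+1) * θ - θ by ring,
        Real.sin_add, Real.sin_sub]; ring
    push_cast at h1 h2 ⊢
    rw [h3]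
    simp only [uu]
    linear_combination 2 * √(N:ℝ) * Real.cos θ * h2 - N * h1 + (√(N:ℝ))^k * Real.sin ((k+1)*θ) * hs

lemma sum_sin (θ : ℝ) (n : ℕ) :
    2 * Real.sin θ * ∑ k ∈ Finset.range n, Real.sin ((k+1) * θ)^2 =
      n * Real.sin θ - (Real.sin ((2*n+1) * θ) - Real.sin θ) / 2 := by
  induction n with
  | zero => simp
  | succ n ih =>
    rw [Finset.sum_range_succ, mul_add, ih]
    push_cast
    rw [show (2 * ((n:ℝ)+1) + 1) * θ = 2 * ((n+1) * θ) + θ by ring,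
      show (2 * (n:ℝ) + 1) * θ = 2 * ((n+1) * θ) - θ by ring,
      Real.sin_add, Real.sin_sub, Real.cos_two_mul']
    have := Real.sin_sq_add_cos_sq ((n+1) * θ)
    linear_combination (Real.sin θ) * this

/-- closed form for the weights -/
lemma sum_uu (N n j : ℕ) (hN : 0 < N) (hj : 0 < j) (hjn : j < n + 2) (y : ℝ)
    (hy : y = 2 * √N * Real.cos (Real.pi * j / (n+2))) :
    uu N y (n+1) = 0 ∧ 0 < 4 * N - y^2 ∧
    (4 * N - y^2) * ∑ k ∈ Finset.range (n+1), uu N y k ^ 2 / (N:ℝ)^k = 2 * (n+2) * N := by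
  set θ := Real.pi * j / (n+2) with hθ
  have hnθ : (n+2) * θ = j * Real.pi := by rw [hθ]; field_simp
  have hs : √(N:ℝ) * √N = N := Real.mul_self_sqrt (by positivity)
  have hN' : (0:ℝ) < N := by positivity
  have hsin : 0 < Real.sin θ := by
    apply Real.sin_pos_of_pos_of_lt_pi
    · rw [hθ]; have := Real.pi_pos; positivity
    · rw [hθ, div_lt_iff₀ (by positivity)]
      have : (j:ℝ) < n + 2 := by exact_mod_cast hjn
      nlinarith [Real.pi_pos]
  have hsc := Real.sin_sq_add_cos_sq θ
  have e4 : 4 * N - y^2 = 4 * N * Real.sin θ^2 := by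
    rw [hy]; linear_combination (-4 * Real.cos θ^2) * hs - 4 * N * hsc
  refine ⟨?_, by rw [e4]; positivity, ?_⟩
  · have := uu_cos N θ (n+1)
    push_cast at this
    rw [show ((n:ℝ)+1+1) * θ = (n+2) * θ by ring, hnθ, Real.sin_nat_mul_pi, mul_zero, ← hy] at this
    exact (mul_eq_zero.1 this).resolve_right hsin.ne'
  · have h1 := sum_sin θ (n+1)
    push_cast at h1
    rw [show (2 * ((n:ℝ)+1) + 1) * θ = j * (2 * Real.pi) - θ by linear_combination 2 * hnθ,
      Real.sin_nat_mul_two_pi_sub] at h1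
    have h2 : ∑ k ∈ Finset.range (n+1), Real.sin ((k+1) * θ)^2 = (n+2)/2 := by
      apply mul_left_cancel₀ (mul_pos two_pos hsin).ne'
      rw [h1]; ring
    rw [e4, mul_assoc, Finset.mul_sum]
    have h3 : ∀ k, Real.sin θ^2 * (uu N y k ^ 2 / (N:ℝ)^k) = Real.sin ((k+1) * θ)^2 := by
      intro k
      have := uu_cos N θ k
      rw [← hy] at this
      have h5 : (√(N:ℝ)^k)^2 = (N:ℝ)^k := by rw [← pow_mul, mul_comm, pow_mul, pow_two, hs]
      rw [← mul_div_assoc, ← mul_pow, mul_comm, this, mul_pow, h5]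
      field_simp
    rw [Finset.sum_congr rfl (fun k _ => h3 k), h2]
    ring

/-- the largest root -/
lemma root_bound (N n : ℕ) (hN : 0 < N) (y : ℝ) (hy : uu N y (n+1) = 0) :
    |y| ≤ 2 * √N * Real.cos (Real.pi / (n+2)) := by
  have hN' : (0:ℝ) < √N := by positivity
  have hs : √(N:ℝ) * √N = N := Real.mul_self_sqrt (by positivity)
  have hU : ∀ k : ℕ, uu N y k = (√N)^k * (Polynomial.Chebyshev.U ℝ k).eval (y / (2 * √N)) := by
    intro k
    induction k using Nat.twoStepInduction with
    | zero => simp [uu]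
    | one => simp [uu]; field_simp
    | more k h1 h2 =>
      simp only [uu, h1, h2]
      push_cast
      rw [Polynomial.Chebyshev.U_add_two]
      simp
      field_simp
      linear_combination (√(N:ℝ) * (Polynomial.Chebyshev.U ℝ k).eval (y / (2 * √N)) * √(N:ℝ)^k) * hs
  rw [hU, mul_eq_zero, or_iff_right (by positivity)] at hy
  have hr : y / (2 * √N) ∈ (Polynomial.Chebyshev.U ℝ ((n+1 : ℕ):ℤ)).roots := by
    rw [Polynomial.mem_roots (Polynomial.Chebyshev.U_ne_zero ℝ _ (by omega))]
    exact hy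
  rw [Polynomial.Chebyshev.roots_U_real] at hr
  simp only [Finset.mem_val, Finset.mem_image, Finset.mem_range] at hr
  obtain ⟨k, hk, hk2⟩ := hr
  have : y = 2 * √N * Real.cos ((k+1) * Real.pi / ((n+1:ℕ)+1)) := by
    rw [hk2]; field_simp
  rw [this, abs_mul, abs_of_pos (by positivity)]
  gcongr
  have hk' : (k:ℝ) + 1 ≤ n + 1 := by exact_mod_cast hk
  have hpi := Real.pi_pos
  push_cast
  rw [abs_le]
  constructor
  · rw [← Real.cos_pi_sub]
    apply Real.cos_le_cos_of_nonneg_of_le_pi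
    · positivity
    · have : Real.pi / (n+2) ≤ Real.pi := div_le_self hpi.le (by linarith)
      have : 0 < Real.pi / (n+2) := by positivity
      linarith
    · rw [show Real.pi - Real.pi / (n+2) = (n+1) * Real.pi / (n+1+1) by field_simp; ring]
      gcongr
  · apply Real.cos_le_cos_of_nonneg_of_le_pi
    · positivity
    · rw [div_le_iff₀ (by positivity)]
      nlinarith
    · rw [show (n:ℝ)+1+1 = n+2 by ring]
      gcongr
      nlinarith [(Nat.cast_nonneg k : (0:ℝ) ≤ k)]

lemma cos_rat_cases (n : ℕ) (hn : 2 ≤ n) (h : ∃ r : ℚ, Real.cos (2 * Real.pi / n) = r) :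
    n = 2 ∨ n = 3 ∨ n = 4 ∨ n = 6 := by
  have hpi := Real.pi_pos
  have hn' : (2:ℝ) ≤ n := by exact_mod_cast hn
  have := niven_angle_eq (θ := 2 * Real.pi / n) ⟨2 / n, by push_cast; ring⟩ h
    ⟨by positivity, by rw [div_le_iff₀ (by positivity)]; nlinarith⟩
  have hn0 : (n:ℝ) ≠ 0 := by positivity
  simp only [Set.mem_insert_iff, Set.mem_singleton_iff] at this
  rcases this with h | h | h | h | h
  · have : 0 < 2 * Real.pi / n := by positivity
    linarith
  · right; right; right
    field_simp at h
    have : (n:ℝ) = 6 := by linarith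
    exact_mod_cast this
  · right; right; left
    field_simp at h
    have : (n:ℝ) = 4 := by linarith
    exact_mod_cast this
  · right; left
    field_simp at h
    have : (n:ℝ) = 3 := by linarith
    exact_mod_cast this
  · left
    field_simp at h
    have : (n:ℝ) = 2 := by linarith
    exact_mod_cast this

lemma sq_rat_cases (N n : ℕ) (hN : 0 < N) (hn : 2 ≤ n) (y : ℝ)
    (hy : y = 2 * √N * Real.cos (Real.pi / n)) (h : ∃ r : ℚ, y^2 = r) :
    n = 2 ∨ n = 3 ∨ n = 4 ∨ n = 6 := by
  apply cos_rat_cases n hn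
  obtain ⟨r, hr⟩ := h
  have hs : √(N:ℝ) * √N = N := Real.mul_self_sqrt (by positivity)
  have hN' : (N:ℝ) ≠ 0 := by positivity
  refine ⟨r / (2 * N) - 1, ?_⟩
  push_cast
  rw [← hr, hy, mul_div_assoc, Real.cos_two_mul]
  field_simp
  linear_combination (-2) * Real.cos (Real.pi / n)^2 * hs

lemma odd_end (q n μ κ : ℕ) (hq : 2 ≤ q) (hκ : 0 < κ) (y : ℝ)
    (hy : y = 2 * √q * Real.cos (Real.pi / n)) (hn : 2 ≤ n)

    (h : μ * (((q:ℝ)+1)^2 - y^2) * (2 * n * q) = κ * (4 * q - y^2)) :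
    n = 2 ∨ n = 3 ∨ n = 4 ∨ n = 6 := by
  apply sq_rat_cases q n (by omega) hn y hy
  have hq' : (2:ℝ) ≤ q := by exact_mod_cast hq
  have hκ' : (0:ℝ) < κ := by exact_mod_cast hκ
  have hc : (μ:ℝ) * (2 * n * q) - κ ≠ 0 := by
    intro hc
    have : (κ:ℝ) * (q-1)^2 = 0 := by linear_combination h - ((q+1)^2 - y^2) * hc
    have : 0 < (κ:ℝ) * (q-1)^2 := by have : (0:ℝ) < q - 1 := by linarith
                                     positivity
    linarith
  refine ⟨(μ * (2 * n * q) * (q+1)^2 - 4 * q * κ) / (μ * (2 * n * q) - κ), ?_⟩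
  push_cast
  rw [eq_div_iff hc]
  linear_combination -h

open Polynomial in
lemma conj_root (g : ℚ[X]) (b c : ℚ) (y : ℝ) (hirr : Irrational y)
    (hy : y^2 + b * y + c = 0) (hg : aeval y g = 0) : aeval (-b - y) g = 0 := by
  set Q : ℚ[X] := X^2 + C b * X + C c with hQ
  have hmonic : Q.Monic := by rw [hQ]; monicity!
  have hdeg : Q.natDegree = 2 := by rw [hQ]; compute_degree!
  have hQy : aeval y Q = 0 := by simpa [hQ] using hy
  have hmod := modByMonic_add_div g Q
  set R := g %ₘ Q with hR
  have hRdeg : R.natDegree < 2 := by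
    rw [← hdeg]; exact natDegree_modByMonic_lt g hmonic (by intro h; rw [h] at hdeg; simp at hdeg)
  have hRe : R = C (R.coeff 1) * X + C (R.coeff 0) := eq_X_add_C_of_natDegree_le_one (by omega)
  have hRy : aeval y R = 0 := by
    have := congrArg (aeval y) hmod
    rw [map_add, map_mul, hQy, hg] at this
    simpa using this
  rw [hRe] at hRy
  simp at hRy
  have h1 : R.coeff 1 = 0 := by
    by_contra h1
    apply hirr
    refine ⟨- R.coeff 0 / R.coeff 1, ?_⟩
    have : (R.coeff 1 : ℝ) ≠ 0 := by exact_mod_cast h1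
    push_cast
    rw [div_eq_iff this]; linarith
  have h0 : R.coeff 0 = 0 := by
    rw [h1] at hRy; simpa using hRy
  have hR0 : R = 0 := by rw [hRe, h1, h0]; simp
  rw [← hmod, hR0, zero_add, map_mul]
  have : aeval (-b - y) Q = 0 := by
    simp [hQ]; linear_combination hy
  rw [this, zero_mul]

lemma even_rat (p q n μ κ : ℕ) (hp : 2 ≤ p) (hq : 2 ≤ q) (hκ : 0 < κ) (y : ℝ)
    (hy : y = 2 * √((p * q : ℕ) : ℝ) * Real.cos (Real.pi / (n + 2)))
    (hroot : uu (p * q) y (n+1) = 0) (hlt : 0 < 4 * ((p * q : ℕ) : ℝ) - y^2)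
    (h : μ * (((p:ℝ) * q + 1 - y) * (p + q + y)) * (2 * (n+2) * ((p * q : ℕ) : ℝ)) =
      κ * (4 * ((p * q : ℕ) : ℝ) - y^2)) :
    ∃ r : ℚ, y = r := by
  by_contra hirr
  have hirr : Irrational y := by
    intro ⟨r, hr⟩; exact hirr ⟨r, hr.symm⟩
  have hp' : (2:ℝ) ≤ p := by exact_mod_cast hp
  have hq' : (2:ℝ) ≤ q := by exact_mod_cast hq
  have hκ' : (0:ℝ) < κ := by exact_mod_cast hκ
  have hy0 : 0 ≤ y := by
    rw [hy]
    have : 0 ≤ Real.cos (Real.pi / (n + 2)) := by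
      apply Real.cos_nonneg_of_neg_pi_div_two_le_of_le
      · have : 0 ≤ Real.pi / (n+2) := by have := Real.pi_pos; positivity
        linarith [Real.pi_pos]
      · have := Real.pi_pos
        gcongr
        linarith [(Nat.cast_nonneg n : (0:ℝ) ≤ n)]
    positivity
  obtain ⟨c, hc⟩ : ∃ c : ℚ, c = μ * (2 * (n+2) * (p * q)) / κ := ⟨_, rfl⟩
  have hc' : (c:ℝ) = μ * (2 * (n+2) * (p * q)) / κ := by rw [hc]; push_cast; rfl
  push_cast at h hlt
  have h1 : (c:ℝ) * (((p:ℝ) * q + 1 - y) * (p + q + y)) = 4 * (p * q) - y^2 := by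
    rw [hc']; field_simp; linear_combination h
  have hy2 : y < 2 * p + 2 * q := by nlinarith
  have hpq : 0 < ((p:ℝ) - 1) * (q - 1) := by
    apply mul_pos <;> linarith
  have hM : 0 < (p:ℝ) * q + 1 - y := by nlinarith [sq_nonneg ((p:ℝ) * q - 1)]
  have hW : 0 < ((p:ℝ) * q + 1 - y) * (p + q + y) := by positivity
  have hc0 : 0 < (c:ℝ) := by
    by_contra hneg
    push Not at hneg
    nlinarith
  have hSM : 4 * ((p:ℝ) * q) < (p + q) * (p * q + 1) := by
    nlinarith [sq_nonneg ((p:ℝ) - q), mul_pos (by linarith : (0:ℝ) < p) (by linarith : (0:ℝ) < q)]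
  have hc1 : (c:ℝ) < 1 := by
    have : (4 * ((p:ℝ) * q) - y^2) < (((p:ℝ) * q + 1 - y) * (p + q + y)) := by
      nlinarith [mul_nonneg hpq.le hy0]
    rw [← h1] at this
    by_contra hge
    push Not at hge
    nlinarith
  have hcne : (c:ℝ) - 1 ≠ 0 := by linarith
  have hconj := conj_root (uu (p*q) Polynomial.X (n+1))
    (- (c * ((p-1) * (q-1)) / (c-1))) ((4 * (p * q) - c * ((p+q) * (p*q+1))) / (c-1)) y hirr
    (by push_cast; field_simp; linear_combination -h1) (by
      have := uu_map (Polynomial.aeval (R := ℚ) y).toRingHom (p*q) Polynomial.X (n+1)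
      simp at this
      rw [this, hroot])
  have hmap := uu_map (Polynomial.aeval (R := ℚ)
    (-((- (c * ((p-1) * (q-1)) / (c-1)) : ℚ) : ℝ) - y)).toRingHom (p*q) Polynomial.X (n+1)
  simp only [AlgHom.toRingHom_eq_coe, RingHom.coe_coe, Polynomial.aeval_X] at hmap
  rw [hmap] at hconj
  have hb := root_bound (p*q) n (by positivity) _ hconj
  rw [← hy] at hb
  have := (abs_le.1 hb).1
  push_cast at this
  have h3 : (c:ℝ) * ((p-1) * (q-1)) / (c-1) < 0 := by
    apply div_neg_of_pos_of_neg
    · positivity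
    · linarith
  rw [neg_neg] at this
  linarith

lemma even_twelve (p q μ κ : ℕ) (hp : 2 ≤ p) (hq : 2 ≤ q) (hκ : 0 < κ) (y : ℝ)
    (hy : y = √((p * q : ℕ) : ℝ))
    (h : μ * (((p:ℝ) * q + 1 - y) * (p + q + y)) * (2 * (4+2) * ((p * q : ℕ) : ℝ)) =
      κ * (4 * ((p * q : ℕ) : ℝ) - y^2)) :
    ∃ r : ℚ, y = r := by
  have hp' : (2:ℝ) ≤ p := by exact_mod_cast hp
  have hq' : (2:ℝ) ≤ q := by exact_mod_cast hq
  have hκ' : (0:ℝ) < κ := by exact_mod_cast hκ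
  have hs : y^2 = p * q := by rw [hy, Real.sq_sqrt (by positivity)]; push_cast; rfl
  push_cast at h
  have hμ : (μ:ℝ) ≠ 0 := by
    intro h0
    rw [h0, hs] at h
    have : 0 < (κ:ℝ) * (4 * (p * q) - p * q) := by
      have : 0 < (p:ℝ) * q := by positivity
      apply mul_pos hκ'; linarith
    linarith
  have h1 : ((p:ℝ) - 1) * (q - 1) ≠ 0 := by
    have : 0 < ((p:ℝ) - 1) * (q - 1) := by apply mul_pos <;> linarith
    exact this.ne'
  refine ⟨(3 * κ / (12 * μ) - (p + q) * (p * q + 1) + p * q) / ((p-1) * (q-1)), ?_⟩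
  push_cast
  rw [eq_div_iff h1]
  have h2 : (3 * κ / (12 * μ) : ℝ) = ((p:ℝ) * q + 1 - y) * (p + q + y) := by
    rw [div_eq_iff (by positivity)]
    have : (p:ℝ) * q ≠ 0 := by positivity
    apply mul_left_cancel₀ this
    linear_combination -h + κ * hs
  rw [h2]
  linear_combination hs

/-- Non-backtracking walk matrices, defined formally. -/
def ff {R : Type*} [Ring R] (A D : R) : ℕ → R
  | 0 => 1
  | 1 => A
  | 2 => A * A - (D + 1)
  | (k+3) => A * ff A D (k+2) - D * ff A D (k+1)

lemma ff_map {R S : Type*} [Ring R] [Ring S] (f : R →+* S) (A D : R) (k : ℕ) :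
    f (ff A D k) = ff (f A) (f D) k ∧ f (ff A D (k+1)) = ff (f A) (f D) (k+1) ∧
      f (ff A D (k+2)) = ff (f A) (f D) (k+2) := by
  induction k with
  | zero => simp [ff]
  | succ k ih => refine ⟨ih.2.1, ih.2.2, ?_⟩; simp [ff, ih]

/-- Even non-backtracking walk matrices. -/
def gg {R : Type*} [Ring R] (X D S N : R) : ℕ → R
  | 0 => 1
  | 1 => X + S - (D + 1)
  | 2 => X * (X + S - (D + 1)) - N - (S - D)
  | (k+3) => X * gg X D S N (k+2) - N * gg X D S N (k+1)

lemma gg_map {R T : Type*} [Ring R] [Ring T] (f : R →+* T) (X D S N : R) (k : ℕ) :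
    f (gg X D S N k) = gg (f X) (f D) (f S) (f N) k ∧
    f (gg X D S N (k+1)) = gg (f X) (f D) (f S) (f N) (k+1) ∧
      f (gg X D S N (k+2)) = gg (f X) (f D) (f S) (f N) (k+2) := by
  induction k with
  | zero => simp [gg]
  | succ k ih => refine ⟨ih.2.1, ih.2.2, ?_⟩; simp [gg, ih]

lemma odd_ident {R : Type*} [CommRing R] (A : R) (q : ℕ) (k : ℕ) :
    (((q:R)+1)^2 - A^2) * uu q A (k+1) = (q:R)^2 * ff A (q:R) (k+1) - ff A (q:R) (k+3) := by
  induction k using Nat.twoStepInduction with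
  | zero => simp only [uu, ff]; ring
  | one => simp only [uu, ff]; ring
  | more k h1 h2 =>
    have e1 : uu q A (k+2+1) = A * uu q A (k+1+1) - (q:R) * uu q A (k+1) := rfl
    have e2 : ff A (q:R) (k+2+1) = A * ff A (q:R) (k+1+1) - (q:R) * ff A (q:R) (k+1) := rfl
    have e3 : ff A (q:R) (k+2+3) = A * ff A (q:R) (k+1+3) - (q:R) * ff A (q:R) (k+3) := rfl
    rw [e1, e2, e3]
    linear_combination A * h2 - (q:R) * h1

lemma even_ident {R : Type*} [CommRing R] (X D S N : R) (n : ℕ) (hN : N = n) (hD : D * (S - D) = N)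
    (k : ℕ) :
    ((N + 1 - X) * (X + S)) * uu n X (k+1) =
      N * D * gg X D S N (k+1) + (N - D) * gg X D S N (k+2) - gg X D S N (k+3) := by
  induction k using Nat.twoStepInduction with
  | zero =>
    simp only [uu, gg]
    linear_combination (X - 1 - N) * hD
  | one =>
    simp only [uu, gg, ← hN]
    linear_combination X * (X - 1 - N) * hD
  | more k h1 h2 =>
    have e1 : uu n X (k+2+1) = X * uu n X (k+1+1) - N * uu n X (k+1) := by rw [hN]; rfl
    have e2 : gg X D S N (k+2+1) = X * gg X D S N (k+1+1) - N * gg X D S N (k+1) := rfl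
    have e3 : gg X D S N (k+2+2) = X * gg X D S N (k+1+2) - N * gg X D S N (k+2) := rfl
    have e4 : gg X D S N (k+2+3) = X * gg X D S N (k+1+3) - N * gg X D S N (k+3) := rfl
    rw [e1, e2, e3, e4]
    linear_combination X * h2 - N * h1

lemma even_ident' {R : Type*} [Ring R] (X D : R) (s n : ℕ) (hXD : X * D = D * X)
    (hD : D * ((s:R) - D) = n) (k : ℕ) :
    (((n:R) + 1 - X) * (X + s)) * uu n X (k+1) =
      n * D * gg X D s n (k+1) + (n - D) * gg X D s n (k+2) - gg X D s n (k+3) := by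
  let T := Algebra.adjoin ℤ ({X, D} : Set R)
  letI : CommRing T := Algebra.adjoinCommRingOfComm ℤ (by
    rintro a (rfl | rfl) b (rfl | rfl) <;> simp [hXD])
  let x : T := ⟨X, Algebra.subset_adjoin (by simp)⟩
  let d : T := ⟨D, Algebra.subset_adjoin (by simp)⟩
  let φ : T →+* R := T.val.toRingHom
  have hφ : Function.Injective φ := Subtype.val_injective
  have hx : φ x = X := rfl
  have hd : φ d = D := rfl
  have h := even_ident x d (s:T) (n:T) n rfl (hφ (by
    rw [map_mul, map_sub, map_natCast, map_natCast, hd, hD])) k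
  have h2 := congrArg φ h
  simp only [map_mul, map_sub, map_add, map_natCast, map_one, uu_map, (gg_map φ x d s n _).1] at h2
  rw [hx, hd] at h2
  exact h2

lemma ff_even {R : Type*} [Ring R] (A D : R) (s n : ℕ)
    (hAD : A * D = ((s:R) - D) * A) (hD : ((s:R) - D) * D = n) (k : ℕ) :
    ff A D (2 * k) = gg (A * A - s) D s n k := by
  have step : ∀ j, ff A D (j+5) = (A * A - s) * ff A D (j+3) - n * ff A D (j+1) := by
    intro j
    have e1 : ff A D (j+5) = A * ff A D (j+4) - D * ff A D (j+3) := rfl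
    have e2 : ff A D (j+4) = A * ff A D (j+3) - D * ff A D (j+2) := rfl
    have e3 : A * ff A D (j+2) = ff A D (j+3) + D * ff A D (j+1) := by
      have : ff A D (j+3) = A * ff A D (j+2) - D * ff A D (j+1) := rfl
      rw [this]; noncomm_ring
    rw [e1, e2, mul_sub, ← mul_assoc A D, hAD, mul_assoc _ A, e3, mul_add, ← mul_assoc _ D, hD]
    noncomm_ring
  have two : ff A D 4 = (A * A - s) * (A * A - s + s - (D + 1)) - n - (s - D) := by
    have e1 : ff A D 4 = A * (A * (A * A - (D+1)) - D * A) - D * (A * A - (D+1)) := rfl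
    have e4 : A * A * D = D * (A * A) := by
      have h1 : A * ((s:R) - D) = D * A := by
        rw [mul_sub, hAD, ← Nat.cast_comm]; noncomm_ring
      rw [mul_assoc, hAD, ← mul_assoc, h1, mul_assoc]
    have e5 : D * D = s * D - n := by rw [← hD]; noncomm_ring
    have e6 : A * (D * A) = s * (A * A) - D * (A * A) := by
      rw [← mul_assoc, hAD]; noncomm_ring
    rw [e1]
    have e7 : A * (A * (A * A - (D+1)) - D * A) - D * (A * A - (D+1)) =
      A * A * (A * A) - A * A * D - A * A - A * (D * A) - D * (A * A) + D * D + D := by noncomm_ring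
    have e8 : (A * A - s) * (A * A - s + s - (D + 1)) - n - (s - D) =
      A * A * (A * A) - A * A * D - A * A - s * (A * A) + s * D + s - n - s + D := by
      noncomm_ring
    rw [e7, e8, e4, e5, e6]; noncomm_ring
  have main : ∀ k, ff A D (2 * k + 2) = gg (A * A - s) D s n (k+1) ∧
      ff A D (2 * k + 4) = gg (A * A - s) D s n (k+2) := by
    intro k
    induction k with
    | zero => exact ⟨by simp [ff, gg], by simpa [gg] using two⟩
    | succ k ih =>
      refine ⟨ih.2, ?_⟩
      have := step (2 * k + 1)
      rw [show 2 * k + 1 + 3 = 2 * k + 4 by ring, show 2 * k + 1 + 1 = 2 * k + 2 by ring, ih.1, ih.2] at this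
      exact this
  cases k with
  | zero => simp [ff, gg]
  | succ k => exact (main k).1

/-- The metric properties of a thick generalized polygon. -/
structure GP {V : Type*} (G : SimpleGraph V) (m : ℕ) : Prop where
  conn : G.Connected
  step : ∀ x z y, G.Adj x z → G.dist z y = G.dist x y + 1 ∨ G.dist z y + 1 = G.dist x y
  diam : ∀ x y, G.dist x y ≤ m
  closer : ∀ x y, G.dist x y ≠ 0 → ∃ z, G.Adj x z ∧ G.dist z y + 1 = G.dist x y
  uniq : ∀ x y z₁ z₂, G.Adj x z₁ → G.Adj x z₂ → G.dist z₁ y + 1 = G.dist x y →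
    G.dist z₂ y + 1 = G.dist x y → G.dist x y < m → z₁ = z₂
  thick : Thick G

lemma egirth_le_of_paths {V : Type*} (G : SimpleGraph V) {u v : V} (p q : G.Walk u v)
    (hp : p.IsPath) (hq : q.IsPath) (hne : p ≠ q) : G.egirth ≤ ((p.length + q.length : ℕ) : ℕ∞) := by
  classical
  set S : Set (Sym2 V) := {e | e ∈ p.edges ∨ e ∈ q.edges} with hS
  have hSG : S ⊆ G.edgeSet := by
    rintro e (he | he)
    · exact p.edges_subset_edgeSet he
    · exact q.edges_subset_edgeSet he
  set H := SimpleGraph.fromEdgeSet S with hH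
  have hHe : H.edgeSet = S := by
    rw [hH, SimpleGraph.edgeSet_fromEdgeSet]
    ext e
    simp only [Set.mem_sdiff]
    refine ⟨fun h => h.1, fun h => ⟨h, fun hd => G.not_isDiag_of_mem_edgeSet (hSG h) hd⟩⟩
  have h1 : ∀ e ∈ p.edges, e ∈ H.edgeSet := fun e he => by rw [hHe]; exact Or.inl he
  have h2 : ∀ e ∈ q.edges, e ∈ H.edgeSet := fun e he => by rw [hHe]; exact Or.inr he
  have hnot : ¬ H.IsAcyclic := by
    intro hac
    have := (hac.subsingleton_path u v).elim ⟨p.transfer H h1, hp.transfer h1⟩ ⟨q.transfer H h2, hq.transfer h2⟩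
    have h3 : p.transfer H h1 = q.transfer H h2 := congrArg Subtype.val this
    apply hne
    apply SimpleGraph.Walk.ext_support
    have := congrArg SimpleGraph.Walk.support h3
    simpa using this
  obtain ⟨a, w, hw, -⟩ := SimpleGraph.exists_egirth_eq_length.2 hnot
  have hwe : ∀ e ∈ w.edges, e ∈ S := fun e he => by rw [← hHe]; exact w.edges_subset_edgeSet he
  have hle : w.length ≤ p.length + q.length := by
    rw [← w.length_edges, ← p.length_edges, ← q.length_edges, ← List.length_append]
    have hnd := hw.edges_nodup
    rw [← List.toFinset_card_of_nodup hnd]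
    refine le_trans (Finset.card_le_card ?_) (List.toFinset_card_le _)
    intro e he
    rw [List.mem_toFinset] at he ⊢
    rw [List.mem_append]
    exact hwe e he
  have hw' : ∀ e ∈ w.edges, e ∈ G.edgeSet := fun e he => hSG (hwe e he)
  have := SimpleGraph.egirth_le_length (hw.transfer hw')
  rw [SimpleGraph.Walk.length_transfer] at this
  exact this.trans (by exact_mod_cast hle)

lemma GP.of {V : Type*} (G : SimpleGraph V) (m : ℕ) (hG : IsGenPolygon G m) (ht : Thick G) :
    GP G m := by
  obtain ⟨hc, ⟨c, hcol⟩, hd, -, hg⟩ := hG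
  let C : G.Coloring Bool := SimpleGraph.Coloring.mk c (fun {v w} h => hcol h)
  refine ⟨hc, ?_, hd, ?_, ?_, ht⟩
  · intro x z y hxz
    obtain ⟨p, hp⟩ := hc.exists_walk_length_eq_dist x y
    obtain ⟨q, hq⟩ := hc.exists_walk_length_eq_dist z y
    have e1 := C.even_length_iff_congr p
    have e2 := C.even_length_iff_congr q
    have hxz' : C x ≠ C z := hcol hxz
    rw [hp] at e1
    rw [hq] at e2
    have t1 : G.dist x y ≤ G.dist x z + G.dist z y := hc.dist_triangle
    have t2 : G.dist z y ≤ G.dist z x + G.dist x y := hc.dist_triangle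
    rw [SimpleGraph.dist_eq_one_iff_adj.2 hxz] at t1
    rw [SimpleGraph.dist_eq_one_iff_adj.2 hxz.symm] at t2
    have hne : G.dist x y ≠ G.dist z y := by
      intro h
      rw [h] at e1
      have h3 : (C x = true ↔ C y = true) ↔ (C z = true ↔ C y = true) := e1.symm.trans e2
      revert h3 hxz'
      cases C x <;> cases C y <;> cases C z <;> simp
    omega
  · intro x y hxy
    obtain ⟨p, hp⟩ := hc.exists_walk_length_eq_dist x y
    cases p with
    | nil => simp at hxy
    | cons h q =>
      rename_i z
      refine ⟨z, h, ?_⟩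
      have t1 : G.dist x y ≤ G.dist x z + G.dist z y := hc.dist_triangle
      rw [SimpleGraph.dist_eq_one_iff_adj.2 h] at t1
      have := SimpleGraph.dist_le q
      simp at hp
      omega
  · intro x y z₁ z₂ h₁ h₂ e₁ e₂ hlt
    by_contra hne
    obtain ⟨p, hp⟩ := hc.exists_walk_length_eq_dist z₁ y
    obtain ⟨q, hq⟩ := hc.exists_walk_length_eq_dist z₂ y
    have P1 := (SimpleGraph.Walk.cons h₁ p).isPath_of_length_eq_dist (by simp [hp, e₁])
    have P2 := (SimpleGraph.Walk.cons h₂ q).isPath_of_length_eq_dist (by simp [hq, e₂])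
    have := egirth_le_of_paths G _ _ P1 P2 (by
      intro h
      apply hne
      have := congrArg SimpleGraph.Walk.snd h
      simpa using this)
    rw [hg] at this
    simp only [SimpleGraph.Walk.length_cons, hp, hq, e₁, e₂] at this
    have : 2 * m ≤ G.dist x y + G.dist x y := by exact_mod_cast this
    omega

section biregular
variable {V : Type*} {G : SimpleGraph V} {m : ℕ}

lemma GP.opp_dist (h : GP G m) {x y z : V} (hxy : G.dist x y = m) (hz : G.Adj x z) :
    G.dist z y + 1 = m := by
  rcases h.step x z y hz with h1 | h1
  · have := h.diam z y; omega
  · omega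

/-- opposite vertices have the same degree -/
lemma GP.opp_deg [Fintype V] [DecidableRel G.Adj] (h : GP G m) (hm : 2 ≤ m) {x y : V}
    (hxy : G.dist x y = m) : G.degree x ≤ G.degree y := by
  classical
  rw [← SimpleGraph.card_neighborFinset_eq_degree, ← SimpleGraph.card_neighborFinset_eq_degree]
  have key : ∀ z, ∃ t, G.Adj x z → G.Adj y t ∧ G.dist z t + 2 = m := by
    intro z
    by_cases hz : G.Adj x z
    · have h1 := h.opp_dist hxy hz
      obtain ⟨t, ht, ht2⟩ := h.closer y z (by rw [SimpleGraph.dist_comm]; omega)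
      refine ⟨t, fun _ => ⟨ht, ?_⟩⟩
      rw [SimpleGraph.dist_comm, SimpleGraph.dist_comm (u := y)] at ht2
      omega
    · exact ⟨z, fun h => absurd h hz⟩
  choose f hf using key
  apply Finset.card_le_card_of_injOn f
  · intro z hz
    simp at hz ⊢
    exact (hf z hz).1
  · intro z₁ h₁ z₂ h₂ he
    simp at h₁ h₂
    have a1 := hf z₁ h₁
    have a2 := hf z₂ h₂
    rw [← he] at a2
    have hyx : G.dist y x = m := by rw [SimpleGraph.dist_comm]; exact hxy
    have := h.opp_dist hyx a1.1
    rw [SimpleGraph.dist_comm] at this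
    exact h.uniq x (f z₁) z₁ z₂ h₁ h₂ (by omega) (by omega) (by omega)

lemma GP.opp_deg_eq [Fintype V] [DecidableRel G.Adj] (h : GP G m) (hm : 2 ≤ m) {x y : V}
    (hxy : G.dist x y = m) : G.degree x = G.degree y :=
  le_antisymm (h.opp_deg hm hxy) (h.opp_deg hm (by rw [SimpleGraph.dist_comm]; exact hxy))

lemma GP.dist_two (h : GP G m) {z x x' : V} (hx : G.Adj z x) (hx' : G.Adj z x') (hne : x ≠ x') :
    G.dist x x' = 2 := by
  have h1 : G.dist z x' = 1 := SimpleGraph.dist_eq_one_iff_adj.2 hx'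
  rcases h.step z x x' hx with h2 | h2
  · omega
  · exact absurd (h.conn.dist_eq_zero_iff.1 (by omega)) hne

lemma GP.exists_far (h : GP G m) {z x x' x'' : V} (hx : G.Adj z x) (hx' : G.Adj z x')
    (hx'' : G.Adj z x'') (h1 : x ≠ x'') (h2 : x' ≠ x'') (d : ℕ) (hd : d + 2 ≤ m) :
    ∃ w, G.dist w z = d + 1 ∧ G.dist w x = d + 2 ∧ G.dist w x' = d + 2 := by
  induction d with
  | zero =>
    exact ⟨x'', SimpleGraph.dist_eq_one_iff_adj.2 hx''.symm, h.dist_two hx'' hx h1.symm,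
      h.dist_two hx'' hx' h2.symm⟩
  | succ d ih =>
    obtain ⟨w, w1, w2, w3⟩ := ih (by omega)
    obtain ⟨u, hu, hu2⟩ := h.closer w z (by omega)
    obtain ⟨w', hw', hne⟩ : ∃ w', G.Adj w w' ∧ w' ≠ u := by
      obtain ⟨a, b, c, ha, hb, hc, hab, -, -⟩ := h.thick w
      by_cases hau : a = u
      · exact ⟨b, hb, fun hbu => hab (hau.trans hbu.symm)⟩
      · exact ⟨a, ha, hau⟩
    have aux : ∀ v, G.Adj z v → G.dist w v = d + 2 → G.dist w' v = d + 3 := by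
      intro v hv hwv
      have t : G.dist u v ≤ G.dist u z + G.dist z v := h.conn.dist_triangle
      rw [SimpleGraph.dist_eq_one_iff_adj.2 hv] at t
      have huv : G.dist u v + 1 = G.dist w v := by
        rcases h.step w u v hu with h3 | h3 <;> omega
      rcases h.step w w' v hw' with h3 | h3
      · omega
      · exact absurd (h.uniq w v w' u hw' hu h3 huv (by omega)) hne
    refine ⟨w', ?_, aux x hx w2, aux x' hx' w3⟩
    rcases h.step w w' z hw' with h3 | h3
    · omega
    · exact absurd (h.uniq w z w' u hw' hu h3 hu2 (by omega)) hne

lemma GP.deg_two [Fintype V] [DecidableRel G.Adj] (h : GP G m) (hm : 2 ≤ m) {z x x' : V}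
    (hx : G.Adj z x) (hx' : G.Adj z x') : G.degree x = G.degree x' := by
  by_cases hne : x = x'
  · rw [hne]
  obtain ⟨x'', hx'', h1, h2⟩ : ∃ x'', G.Adj z x'' ∧ x ≠ x'' ∧ x' ≠ x'' := by
    obtain ⟨a, b, c, ha, hb, hc, hab, hac, hbc⟩ := h.thick z
    by_cases a1 : x = a
    · by_cases b1 : x' = b
      · exact ⟨c, hc, a1 ▸ hac, b1 ▸ hbc⟩
      · exact ⟨b, hb, a1 ▸ hab, b1⟩
    · by_cases a2 : x' = a
      · by_cases b1 : x = b
        · exact ⟨c, hc, b1 ▸ hbc, a2 ▸ hac⟩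
        · exact ⟨b, hb, b1, a2 ▸ hab⟩
      · exact ⟨a, ha, a1, a2⟩
  obtain ⟨w, -, w2, w3⟩ := h.exists_far hx hx' hx'' h1 h2 (m-2) (by omega)
  rw [← h.opp_deg_eq hm (show G.dist w x = m by omega),
    ← h.opp_deg_eq hm (show G.dist w x' = m by omega)]

lemma GP.deg_ge [Fintype V] [DecidableRel G.Adj] (h : GP G m) (x : V) : 3 ≤ G.degree x := by
  classical
  obtain ⟨a, b, c, ha, hb, hc, hab, hac, hbc⟩ := h.thick x
  rw [← SimpleGraph.card_neighborFinset_eq_degree, ← Finset.card_eq_three.2 ⟨a, b, c, hab, hac, hbc, rfl⟩]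
  apply Finset.card_le_card
  intro t ht
  simp at ht ⊢
  rcases ht with rfl | rfl | rfl <;> assumption

/-- biregularity -/
lemma GP.biregular [Fintype V] [DecidableRel G.Adj] (h : GP G m) (hm : 2 ≤ m) :
    ∃ p q : ℕ, 2 ≤ p ∧ 2 ≤ q ∧ ∀ x y, G.Adj x y →
      (G.degree x = p + 1 ∧ G.degree y = q + 1) ∨ (G.degree x = q + 1 ∧ G.degree y = p + 1) := by
  obtain ⟨u⟩ := h.conn.nonempty
  obtain ⟨w, -, -, huw, -⟩ := h.thick u
  have d1 := h.deg_ge u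
  have d2 := h.deg_ge w
  refine ⟨G.degree u - 1, G.degree w - 1, by omega, by omega, ?_⟩
  rw [Nat.sub_add_cancel (by omega), Nat.sub_add_cancel (by omega)]
  intro x
  have hr := h.conn u x
  rw [SimpleGraph.reachable_iff_reflTransGen] at hr
  induction hr with
  | refl => intro y hy; exact Or.inl ⟨rfl, h.deg_two hm hy huw⟩
  | tail _ hab ih =>
    intro y hy
    rw [h.deg_two hm hy hab.symm]
    exact (ih _ hab).symm.imp (fun h => ⟨h.2, h.1⟩) (fun h => ⟨h.2, h.1⟩)

end biregular

section matrices
variable {V : Type*} {G : SimpleGraph V} {m : ℕ}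

/-- distance matrix -/
noncomputable def dm (G : SimpleGraph V) (k : ℕ) : Matrix V V ℝ :=
  Matrix.of fun x y => if G.dist x y = k then 1 else 0

/-- degree minus one -/
noncomputable def dg (G : SimpleGraph V) [Fintype V] [DecidableEq V] [DecidableRel G.Adj] :
    Matrix V V ℝ := Matrix.diagonal fun x => (G.degree x : ℝ) - 1

variable [Fintype V] [DecidableEq V] [DecidableRel G.Adj]

lemma dg_mul_apply (M : Matrix V V ℝ) (x y : V) : (dg G * M) x y = ((G.degree x : ℝ) - 1) * M x y := by
  simp [dg]

lemma adj_dm (k : ℕ) (x y : V) : (G.adjMatrix ℝ * dm G k) x y =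
    ∑ z ∈ G.neighborFinset x, if G.dist z y = k then 1 else 0 := by
  rw [SimpleGraph.adjMatrix_mul_apply]; rfl

lemma GP.adj_dm_zero (h : GP G m) (k : ℕ) (x y : V) (hd : G.dist x y = 0) :
    (G.adjMatrix ℝ * dm G k) x y = if k = 1 then (G.degree x : ℝ) else 0 := by
  rw [adj_dm, Finset.sum_congr rfl (g := fun z => if k = 1 then (1:ℝ) else 0)]
  · rw [Finset.sum_const, SimpleGraph.card_neighborFinset_eq_degree]; simp
  · intro z hz
    rw [SimpleGraph.mem_neighborFinset] at hz
    have : G.dist z y = 1 := by rcases h.step x z y hz with h1 | h1 <;> omega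
    rw [this]; simp [eq_comm]

lemma GP.adj_dm_opp (h : GP G m) (k : ℕ) (x y : V) (hd : G.dist x y = m) :
    (G.adjMatrix ℝ * dm G k) x y = if k + 1 = m then (G.degree x : ℝ) else 0 := by
  rw [adj_dm, Finset.sum_congr rfl (g := fun z => if k + 1 = m then (1:ℝ) else 0)]
  · rw [Finset.sum_const, SimpleGraph.card_neighborFinset_eq_degree]; simp
  · intro z hz
    rw [SimpleGraph.mem_neighborFinset] at hz
    have := h.opp_dist hd hz
    apply if_congr _ rfl rfl
    omega

lemma GP.adj_dm_mid (h : GP G m) (k : ℕ) (x y : V) (hd0 : G.dist x y ≠ 0) (hd : G.dist x y < m) :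
    (G.adjMatrix ℝ * dm G k) x y = (if k + 1 = G.dist x y then 1 else 0) +
      if k = G.dist x y + 1 then (G.degree x : ℝ) - 1 else 0 := by
  obtain ⟨u, hu, hu2⟩ := h.closer x y hd0
  have hmem : u ∈ G.neighborFinset x := by simpa using hu
  rw [adj_dm, ← Finset.add_sum_erase _ _ hmem]
  congr 1
  · apply if_congr _ rfl rfl; omega
  · rw [Finset.sum_congr rfl (g := fun z => if k = G.dist x y + 1 then (1:ℝ) else 0)]
    · rw [Finset.sum_const, Finset.card_erase_of_mem hmem,
        SimpleGraph.card_neighborFinset_eq_degree]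
      have := h.deg_ge x
      simp [Nat.cast_sub (show 1 ≤ G.degree x by omega)]
    · intro z hz
      rw [Finset.mem_erase, SimpleGraph.mem_neighborFinset] at hz
      have : G.dist z y = G.dist x y + 1 := by
        rcases h.step x z y hz.2 with h1 | h1
        · exact h1
        · exact absurd (h.uniq x y z u hz.2 hu h1 hu2 hd) hz.1
      rw [this]; apply if_congr _ rfl rfl; omega

lemma GP.dm_zero (h : GP G m) : dm G 0 = 1 := by
  ext x y
  rw [Matrix.one_apply]
  exact if_congr h.conn.dist_eq_zero_iff rfl rfl

lemma dm_one : dm G 1 = G.adjMatrix ℝ := by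
  ext x y
  rw [SimpleGraph.adjMatrix_apply]
  exact if_congr SimpleGraph.dist_eq_one_iff_adj rfl rfl

lemma GP.rel_two (h : GP G m) (hm : 2 < m) :
    G.adjMatrix ℝ * G.adjMatrix ℝ = dm G 2 + (dg G + 1) := by
  nth_rw 2 [← dm_one]
  rw [← h.dm_zero]
  ext x y
  have e : (dg G) x y = ((G.degree x : ℝ) - 1) * dm G 0 x y := by
    rw [← dg_mul_apply, h.dm_zero, mul_one]
  rw [Matrix.add_apply, Matrix.add_apply, e]
  simp only [dm, Matrix.of_apply]
  by_cases h0 : G.dist x y = 0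
  · rw [show (Matrix.of fun x y => if G.dist x y = 1 then (1:ℝ) else 0) = dm G 1 from rfl,
      h.adj_dm_zero _ _ _ h0]; simp [h0]
  · rw [show (Matrix.of fun x y => if G.dist x y = 1 then (1:ℝ) else 0) = dm G 1 from rfl]
    by_cases h1 : G.dist x y = m
    · rw [h.adj_dm_opp _ _ _ h1, if_neg (by omega), if_neg (by omega), if_neg h0]; simp
    · have := h.diam x y
      rw [h.adj_dm_mid _ _ _ h0 (by omega), if_neg (show ¬ (1 = G.dist x y + 1) by omega), if_neg h0]
      simp [eq_comm]

lemma GP.rel_mid (h : GP G m) (k : ℕ) (hk : 1 ≤ k) (hm : k + 2 < m) :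
    G.adjMatrix ℝ * dm G (k+1) = dm G (k+2) + dg G * dm G k := by
  ext x y
  rw [Matrix.add_apply, dg_mul_apply]
  have := h.diam x y
  by_cases h0 : G.dist x y = 0
  · rw [h.adj_dm_zero _ _ _ h0]
    simp only [dm, Matrix.of_apply]
    rw [if_neg (by omega), if_neg (by omega), if_neg (by omega)]; simp
  · by_cases h1 : G.dist x y = m
    · rw [h.adj_dm_opp _ _ _ h1]
      simp only [dm, Matrix.of_apply]
      rw [if_neg (by omega), if_neg (by omega), if_neg (by omega)]; simp
    · rw [h.adj_dm_mid _ _ _ h0 (by omega)]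
      simp only [dm, Matrix.of_apply, mul_ite, mul_one, mul_zero]
      congr 1
      · apply if_congr _ rfl rfl; omega
      · apply if_congr _ rfl rfl; omega

lemma GP.rel_pre (h : GP G m) (k : ℕ) (hk : 1 ≤ k) (hm : k + 2 = m) :
    G.adjMatrix ℝ * dm G (k+1) = (dg G + 1) * dm G (k+2) + dg G * dm G k := by
  ext x y
  rw [add_mul, one_mul, Matrix.add_apply, Matrix.add_apply, dg_mul_apply, dg_mul_apply]
  have := h.diam x y
  by_cases h0 : G.dist x y = 0
  · rw [h.adj_dm_zero _ _ _ h0]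
    simp only [dm, Matrix.of_apply]
    rw [if_neg (by omega), if_neg (by omega), if_neg (by omega)]; simp
  · by_cases h1 : G.dist x y = m
    · rw [h.adj_dm_opp _ _ _ h1]
      simp only [dm, Matrix.of_apply]
      rw [if_pos (by omega), if_pos (by omega), if_neg (by omega)]; simp
    · rw [h.adj_dm_mid _ _ _ h0 (by omega)]
      simp only [dm, Matrix.of_apply, mul_ite, mul_one, mul_zero]
      rw [if_neg (show ¬ (k + 1 + 1 = G.dist x y) by omega), if_neg (show ¬ (G.dist x y = k + 2) by omega),
        if_neg (show ¬ (G.dist x y = k + 2) by omega), add_zero]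
      congr 1
      apply if_congr _ rfl rfl; omega

lemma GP.rel_top (h : GP G m) (k : ℕ) (hk : 1 ≤ k) (hm : k + 1 = m) :
    G.adjMatrix ℝ * dm G (k+1) = dg G * dm G k := by
  ext x y
  rw [dg_mul_apply]
  have := h.diam x y
  by_cases h0 : G.dist x y = 0
  · rw [h.adj_dm_zero _ _ _ h0]
    simp only [dm, Matrix.of_apply]
    rw [if_neg (by omega), if_neg (by omega)]; simp
  · by_cases h1 : G.dist x y = m
    · rw [h.adj_dm_opp _ _ _ h1]
      simp only [dm, Matrix.of_apply]
      rw [if_neg (by omega), if_neg (by omega)]; simp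
    · rw [h.adj_dm_mid _ _ _ h0 (by omega)]
      simp only [dm, Matrix.of_apply, mul_ite, mul_one, mul_zero]
      rw [if_neg (show ¬ (k + 1 + 1 = G.dist x y) by omega), zero_add]
      apply if_congr _ rfl rfl; omega

lemma GP.ff_dm (h : GP G m) (k : ℕ) (hk : k < m) : ff (G.adjMatrix ℝ) (dg G) k = dm G k := by
  induction k using Nat.strong_induction_on with
  | _ k ih =>
    match k, hk, ih with
    | 0, _, _ => rw [h.dm_zero]; rfl
    | 1, _, _ => rw [dm_one]; rfl
    | 2, hk, _ =>
      have := h.rel_two hk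
      change G.adjMatrix ℝ * G.adjMatrix ℝ - (dg G + 1) = _
      rw [this]; abel
    | k+3, hk, ih =>
      change G.adjMatrix ℝ * ff (G.adjMatrix ℝ) (dg G) (k+2) - dg G * ff (G.adjMatrix ℝ) (dg G) (k+1) = _
      rw [ih (k+2) (by omega) (by omega), ih (k+1) (by omega) (by omega),
        h.rel_mid (k+1) (by omega) (by omega)]
      abel

lemma GP.ff_top (h : GP G m) (hm : 3 ≤ m) :
    ff (G.adjMatrix ℝ) (dg G) m = (dg G + 1) * dm G m := by
  obtain ⟨k, rfl⟩ := Nat.exists_eq_add_of_le' hm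
  change G.adjMatrix ℝ * ff (G.adjMatrix ℝ) (dg G) (k+2) - dg G * ff (G.adjMatrix ℝ) (dg G) (k+1) = _
  rw [h.ff_dm (k+2) (by omega), h.ff_dm (k+1) (by omega), h.rel_pre (k+1) (by omega) (by omega)]
  abel

lemma GP.ff_top_one (h : GP G m) (hm : 3 ≤ m) (s n : ℕ)
    (hAD : G.adjMatrix ℝ * dg G = ((s : Matrix V V ℝ) - dg G) * G.adjMatrix ℝ)
    (hD : ((s : Matrix V V ℝ) - dg G) * dg G = n) :
    ff (G.adjMatrix ℝ) (dg G) (m+1) = n * dm G (m-1) := by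
  obtain ⟨k, rfl⟩ := Nat.exists_eq_add_of_le' hm
  change G.adjMatrix ℝ * ff (G.adjMatrix ℝ) (dg G) (k+3) - dg G * ff (G.adjMatrix ℝ) (dg G) (k+2) = _
  rw [h.ff_top hm, h.ff_dm (k+2) (by omega), ← mul_assoc, mul_add, mul_one, hAD, add_mul, mul_assoc,
    h.rel_top (k+2) (by omega) rfl, ← mul_assoc, hD]
  simp

lemma GP.ff_top_two (h : GP G m) (hm : 3 ≤ m) (s n : ℕ)
    (hAD : G.adjMatrix ℝ * dg G = ((s : Matrix V V ℝ) - dg G) * G.adjMatrix ℝ)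
    (hD : ((s : Matrix V V ℝ) - dg G) * dg G = n) :
    n * dg G * ff (G.adjMatrix ℝ) (dg G) (m-2) + (n - dg G) * ff (G.adjMatrix ℝ) (dg G) m
      - ff (G.adjMatrix ℝ) (dg G) (m+2) = 0 := by
  have h1 := h.ff_top_one hm s n hAD hD
  have h2 := h.ff_top hm
  obtain ⟨k, rfl⟩ := Nat.exists_eq_add_of_le' hm
  have e : ff (G.adjMatrix ℝ) (dg G) (k+3+2) =
    G.adjMatrix ℝ * ff (G.adjMatrix ℝ) (dg G) (k+3+1) - dg G * ff (G.adjMatrix ℝ) (dg G) (k+3) := rfl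
  have h3 := h.rel_pre (k+1) (by omega) (by omega)
  have hc : G.adjMatrix ℝ * ((n : Matrix V V ℝ) * dm G (k+2)) =
      n * (G.adjMatrix ℝ * dm G (k+2)) := by
    rw [← mul_assoc, ← Nat.cast_comm, mul_assoc]
  rw [e, h1, h2]
  simp only [show k + 3 - 2 = k + 1 by omega, show k + 3 - 1 = k + 2 by omega]
  rw [h.ff_dm (k+1) (by omega), hc, h3]
  noncomm_ring

lemma trace_dg_dm (v : V → ℝ) (k : ℕ) (hk : 1 ≤ k) : (Matrix.diagonal v * dm G k).trace = 0 := by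
  unfold Matrix.trace
  apply Finset.sum_eq_zero
  intro x _
  simp [dm]
  omega

lemma GP.trace_ff (h : GP G m) (hm : 3 ≤ m) (v : V → ℝ) (k : ℕ) (hk : 1 ≤ k) (hkm : k ≤ m) :
    (Matrix.diagonal v * ff (G.adjMatrix ℝ) (dg G) k).trace = 0 := by
  rcases hkm.lt_or_eq with h1 | rfl
  · rw [h.ff_dm k h1, trace_dg_dm v k hk]
  · rw [h.ff_top hm, ← mul_assoc, dg, ← Matrix.diagonal_one, Matrix.diagonal_add,
      Matrix.diagonal_mul_diagonal, trace_dg_dm _ k hk]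

end matrices

section final
variable {V : Type*} {G : SimpleGraph V} {m : ℕ}
variable [Fintype V] [DecidableEq V] [DecidableRel G.Adj]

lemma GP.parity (h : GP G m) (s : ℕ) (hs : ∀ x y, G.Adj x y → G.degree x + G.degree y = s)
    (n : ℕ) : ∀ x y, G.dist x y = n → (n % 2 = 0 → G.degree x = G.degree y) ∧
      (n % 2 = 1 → G.degree x + G.degree y = s) := by
  induction n with
  | zero =>
    intro x y hxy
    have := (h.conn.dist_eq_zero_iff).1 hxy
    subst this
    exact ⟨fun _ => rfl, by omega⟩
  | succ n ih =>
    intro x y hxy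
    obtain ⟨z, hz, hz2⟩ := h.closer x y (by omega)
    have h1 := ih z y (by omega)
    have h2 := hs x z hz
    constructor
    · intro h3
      have := h1.2 (by omega)
      omega
    · intro h3
      have := h1.1 (by omega)
      omega

/-- biregularity data -/
def Bireg (G : SimpleGraph V) [DecidableRel G.Adj] (p q : ℕ) : Prop :=
  ∀ x y, G.Adj x y →
      (G.degree x = p + 1 ∧ G.degree y = q + 1) ∨ (G.degree x = q + 1 ∧ G.degree y = p + 1)

lemma GP.deg_cases (h : GP G m) {p q : ℕ} (hb : Bireg G p q) (x : V) :
    G.degree x = p + 1 ∨ G.degree x = q + 1 := by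
  obtain ⟨a, _, _, ha, _⟩ := h.thick x
  rcases hb x a ha with h1 | h1
  · exact Or.inl h1.1
  · exact Or.inr h1.1

lemma cast_diag (n : ℕ) : (n : Matrix V V ℝ) = Matrix.diagonal fun _ => (n : ℝ) := by
  exact (Matrix.diagonal_natCast n).symm

lemma hAD_of {p q : ℕ} (hb : Bireg G p q) :
    G.adjMatrix ℝ * dg G = (((p + q : ℕ) : Matrix V V ℝ) - dg G) * G.adjMatrix ℝ := by
  rw [cast_diag, dg, Matrix.diagonal_sub]
  ext x y
  rw [Matrix.mul_diagonal, Matrix.diagonal_mul]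
  by_cases hxy : G.Adj x y
  · simp only [SimpleGraph.adjMatrix_apply, hxy, if_true]
    rcases hb x y hxy with ⟨h1, h2⟩ | ⟨h1, h2⟩ <;> rw [h1, h2] <;> push_cast <;> ring
  · simp [SimpleGraph.adjMatrix_apply, hxy]

lemma GP.hD_of (h : GP G m) {p q : ℕ} (hb : Bireg G p q) :
    (((p + q : ℕ) : Matrix V V ℝ) - dg G) * dg G = ((p * q : ℕ) : Matrix V V ℝ) := by
  rw [cast_diag, cast_diag, dg, Matrix.diagonal_sub, Matrix.diagonal_mul_diagonal]
  congr 1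
  ext x
  rcases h.deg_cases hb x with h1 | h1 <;> rw [h1] <;> push_cast <;> ring

lemma GP.hD_of' (h : GP G m) {p q : ℕ} (hb : Bireg G p q) :
    dg G * (((p + q : ℕ) : Matrix V V ℝ) - dg G) = ((p * q : ℕ) : Matrix V V ℝ) := by
  rw [← h.hD_of hb, mul_sub, sub_mul, Nat.cast_comm]

lemma hXD_of {p q : ℕ} (hb : Bireg G p q) :
    (G.adjMatrix ℝ * G.adjMatrix ℝ - ((p + q : ℕ) : Matrix V V ℝ)) * dg G =
      dg G * (G.adjMatrix ℝ * G.adjMatrix ℝ - ((p + q : ℕ) : Matrix V V ℝ)) := by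
  have h1 := hAD_of hb
  have h2 : G.adjMatrix ℝ * (((p + q : ℕ) : Matrix V V ℝ) - dg G) = dg G * G.adjMatrix ℝ := by
    rw [mul_sub, h1, sub_mul, Nat.cast_comm]; abel
  rw [sub_mul, mul_sub, mul_assoc, h1, ← mul_assoc, h2, Nat.cast_comm, mul_assoc]

lemma trace_nat_dg (n : ℕ) (M : Matrix V V ℝ) :
    (n * dg G * M) = Matrix.diagonal (fun x => n * ((G.degree x : ℝ) - 1)) * M := by
  rw [cast_diag, dg, Matrix.diagonal_mul_diagonal]

lemma trace_nat_sub (n : ℕ) (M : Matrix V V ℝ) :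
    ((n - dg G) * M) = Matrix.diagonal (fun x => n - ((G.degree x : ℝ) - 1)) * M := by
  rw [cast_diag, dg, Matrix.diagonal_sub]

lemma GP.trace_ff_one (h : GP G m) (hm : 3 ≤ m) (k : ℕ) (hk : 1 ≤ k) (hkm : k ≤ m) :
    (ff (G.adjMatrix ℝ) (dg G) k).trace = 0 := by
  have := h.trace_ff hm (fun _ => 1) k hk hkm
  rwa [Matrix.diagonal_one, one_mul] at this

open Polynomial in
lemma GP.regular (h : GP G m) (hm : 5 ≤ m) (q : ℕ) (hq : 2 ≤ q) (hb : Bireg G q q) [Nonempty V] :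
    m = 2 ∨ m = 3 ∨ m = 4 ∨ m = 6 := by
  obtain ⟨n, rfl⟩ := Nat.exists_eq_add_of_le' (show 2 ≤ m by omega)
  have hdg : dg G = (q : Matrix V V ℝ) := by
    rw [cast_diag, dg]
    congr 1; ext x
    rcases h.deg_cases hb x with h1 | h1 <;> rw [h1] <;> push_cast <;> ring
  set A := G.adjMatrix ℝ with hA
  set w : ℝ[X] := ((q : ℝ[X]) + 1)^2 - X^2 with hw
  have key : ∀ k, aeval A w * uu q A (k+1) =
      (q : Matrix V V ℝ)^2 * ff A (dg G) (k+1) - ff A (dg G) (k+3) := by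
    intro k
    have := congrArg (aeval A : ℝ[X] →ₐ[ℝ] Matrix V V ℝ).toRingHom (odd_ident (X : ℝ[X]) q k)
    rw [map_mul, map_sub, map_sub, map_mul, uu_map, (ff_map _ _ _ (k+1)).1, (ff_map _ _ _ (k+3)).1] at this
    rw [hdg]
    simpa [hw] using this
  have hann : aeval A w * uu q A (n+1) = 0 := by
    rw [key]
    have h1 := h.ff_top_one (by omega) _ _ (hAD_of hb) (h.hD_of hb)
    rw [show n + 2 + 1 = n + 3 by omega, show n + 2 - 1 = n + 1 by omega] at h1
    rw [h1, h.ff_dm (n+1) (by omega)]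
    push_cast
    rw [pow_two, sub_self]
  have htr : ∀ k, 1 ≤ k → k ≤ n → (aeval A w * uu q A k).trace = 0 := by
    intro k hk hkn
    obtain ⟨k, rfl⟩ := Nat.exists_eq_add_of_le' hk
    rw [key, Matrix.trace_sub, h.trace_ff_one (by omega) (k+3) (by omega) (by omega),
      ← Nat.cast_pow, cast_diag, h.trace_ff (by omega) _ (k+1) (by omega) (by omega), sub_zero]
  have htrW : (aeval A w).trace = ((Fintype.card V * (q * (q+1)) : ℕ) : ℝ) := by
    have h2 : aeval A w = ((q * (q + 1) : ℕ) : Matrix V V ℝ) - ff A (dg G) 2 := by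
      simp only [hw, ff, hdg, map_sub, map_pow, map_add, aeval_X, map_one, map_natCast]
      push_cast
      noncomm_ring
    rw [h2, Matrix.trace_sub, h.trace_ff_one (by omega) 2 (by omega) (by omega), cast_diag]
    simp [Matrix.trace]
  set y : ℝ := 2 * √q * Real.cos (Real.pi / (n+2 : ℕ)) with hy
  obtain ⟨s1, s2, s3⟩ := sum_uu q n 1 (by omega) (by omega) (by omega) y
    (by rw [hy]; push_cast; rw [mul_one])
  have hwy : w.eval y = ((q:ℝ)+1)^2 - y^2 := by simp [hw]
  have hwpos : 0 < w.eval y := by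
    rw [hwy]; nlinarith [sq_nonneg ((q:ℝ)-1)]
  obtain ⟨μ, hμ⟩ := mult_int A w q n (by omega) y hann htr s1 hwpos.ne'
  rw [htrW, hwy] at hμ
  apply odd_end q (n+2) μ (Fintype.card V * (q * (q+1))) hq _ y hy (by omega)
  · rw [← hμ]
    push_cast
    linear_combination (-(μ : ℝ) * (((q:ℝ)+1)^2 - y^2)) * s3
  · have := Fintype.card_pos (α := V)
    positivity

open Polynomial in
lemma GP.even_core (n : ℕ) (h : GP G (2 * (n + 2))) (hn : 1 ≤ n) (p q : ℕ) (hp : 2 ≤ p)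
    (hq : 2 ≤ q) (hb : Bireg G p q) [Nonempty V] : ∃ κ : ℕ, 0 < κ ∧ ∀ (j : ℕ), 0 < j → j < n + 2 →
    ∀ y : ℝ, y = 2 * √((p*q : ℕ) : ℝ) * Real.cos (Real.pi * j / (n+2)) →
    uu (p*q) y (n+1) = 0 ∧ 0 < 4 * ((p*q : ℕ) : ℝ) - y^2 ∧ ∃ μ : ℕ,
    μ*(((p:ℝ)*q+1-y)*(p+q+y))*(2*(n+2)*((p*q:ℕ):ℝ)) = κ*(4*((p*q:ℕ):ℝ)-y^2) := by
  set A := G.adjMatrix ℝ with hA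
  set M : Matrix V V ℝ := A * A - ((p + q : ℕ) : Matrix V V ℝ) with hM
  set w : ℝ[X] := (((p * q : ℕ) : ℝ[X]) + 1 - X) * (X + ((p + q : ℕ) : ℝ[X])) with hw
  have hwM : aeval M w = (((p * q : ℕ) : Matrix V V ℝ) + 1 - M) * (M + ((p + q : ℕ) : Matrix V V ℝ)) := by
    simp only [hw, map_mul, map_sub, map_add, aeval_X, map_one, map_natCast]
  have hg : ∀ k, gg M (dg G) ((p+q : ℕ) : Matrix V V ℝ) ((p*q : ℕ) : Matrix V V ℝ) k =
      ff A (dg G) (2 * k) := fun k =>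
    (ff_even A (dg G) (p+q) (p*q) (hAD_of hb) (h.hD_of hb) k).symm
  have key : ∀ k, aeval M w * uu (p*q) M (k+1) =
      ((p * q : ℕ) : Matrix V V ℝ) * dg G * ff A (dg G) (2*(k+1)) +
        (((p * q : ℕ) : Matrix V V ℝ) - dg G) * ff A (dg G) (2*(k+2)) - ff A (dg G) (2*(k+3)) := by
    intro k
    rw [hwM, even_ident' M (dg G) (p+q) (p*q) (hXD_of hb) (h.hD_of' hb) k, hg, hg, hg]
  have hann : aeval M w * uu (p*q) M (n+1) = 0 := by
    rw [key]
    have h1 := h.ff_top_two (by omega) _ _ (hAD_of hb) (h.hD_of hb)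
    rw [show 2 * (n+2) - 2 = 2 * (n+1) by omega, show 2 * (n+2) + 2 = 2 * (n+3) by omega] at h1
    exact h1
  have htr : ∀ k, 1 ≤ k → k ≤ n → (aeval M w * uu (p*q) M k).trace = 0 := by
    intro k hk hkn
    obtain ⟨k, rfl⟩ := Nat.exists_eq_add_of_le' hk
    rw [key, Matrix.trace_sub, Matrix.trace_add,
      h.trace_ff_one (by omega) (2*(k+3)) (by omega) (by omega),
      trace_nat_dg, trace_nat_sub, h.trace_ff (by omega) _ (2*(k+1)) (by omega) (by omega),
      h.trace_ff (by omega) _ (2*(k+2)) (by omega) (by omega)]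
    simp
  have htrW : (aeval M w).trace = ((p * q * ∑ x, G.degree x : ℕ) : ℝ) := by
    have hD := h.hD_of hb
    have hXD := hXD_of hb
    have h2 : aeval M w = ((p * q : ℕ) : Matrix V V ℝ) * (dg G + 1) +
        (((p * q : ℕ) : Matrix V V ℝ) - dg G) * ff A (dg G) (2*1) - ff A (dg G) (2*2) := by
      rw [hwM, ← hg, ← hg]
      rw [← hM] at hXD
      simp only [gg]
      have c1 : M * ((p * q : ℕ) : Matrix V V ℝ) = ((p * q : ℕ) : Matrix V V ℝ) * M :=
        (Nat.cast_comm _ _).symm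
      have c2 : M * ((p + q : ℕ) : Matrix V V ℝ) = ((p + q : ℕ) : Matrix V V ℝ) * M :=
        (Nat.cast_comm _ _).symm
      have c3 : dg G * ((p + q : ℕ) : Matrix V V ℝ) = ((p + q : ℕ) : Matrix V V ℝ) * dg G :=
        (Nat.cast_comm _ _).symm
      have c4 : ((p + q : ℕ) : Matrix V V ℝ) * dg G = dg G * dg G + ((p * q : ℕ) : Matrix V V ℝ) := by
        rw [← hD]; noncomm_ring
      simp only [mul_add, add_mul, mul_sub, sub_mul, c2, c3, c4, hXD, one_mul, mul_one]
      abel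
    rw [h2, Matrix.trace_sub, Matrix.trace_add,
      h.trace_ff_one (by omega) (2*2) (by omega) (by omega), trace_nat_sub,
      h.trace_ff (by omega) _ (2*1) (by omega) (by omega), cast_diag, dg, ← Matrix.diagonal_one,
      Matrix.diagonal_add, Matrix.diagonal_mul_diagonal]
    simp [Matrix.trace, Finset.mul_sum]
  refine ⟨p * q * ∑ x, G.degree x, ?_, ?_⟩
  · have : 0 < ∑ x, G.degree x := by
      apply Finset.sum_pos
      · intro x _
        have := h.deg_ge x
        omega
      · exact Finset.univ_nonempty
    positivity
  · intro j hj hjn y hy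
    have hpq : 0 < p * q := by positivity
    obtain ⟨s1, s2, s3⟩ := sum_uu (p*q) n j hpq hj hjn y hy
    refine ⟨s1, s2, ?_⟩
    have hwy : w.eval y = ((p:ℝ)*q+1-y)*(p+q+y) := by
      simp only [hw, eval_mul, eval_sub, eval_add, eval_X, eval_one, eval_natCast]
      push_cast
      ring
    have hp' : (2:ℝ) ≤ p := by exact_mod_cast hp
    have hq' : (2:ℝ) ≤ q := by exact_mod_cast hq
    have s2' : y^2 < 4 * (p * q) := by push_cast at s2; linarith
    have hwpos : 0 < w.eval y := by
      rw [hwy]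
      apply mul_pos
      · have : |y| < (p:ℝ)*q+1 := by
          apply abs_lt_of_sq_lt_sq _ (by positivity)
          nlinarith [sq_nonneg ((p:ℝ)*q-1)]
        linarith [le_abs_self y]
      · have : |y| < (p:ℝ)+q := by
          apply abs_lt_of_sq_lt_sq _ (by positivity)
          nlinarith [sq_nonneg ((p:ℝ)-q)]
        linarith [neg_abs_le y]
    obtain ⟨μ, hμ⟩ := mult_int M w (p*q) n hpq y hann htr s1 hwpos.ne'
    refine ⟨μ, ?_⟩
    rw [htrW, hwy] at hμ
    rw [← hμ]
    linear_combination (-(μ : ℝ) * (((p:ℝ)*q+1-y)*(p+q+y))) * s3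

lemma GP.even_case (n : ℕ) (h : GP G (2 * (n + 2))) (hn : 1 ≤ n) (p q : ℕ) (hp : 2 ≤ p)
    (hq : 2 ≤ q) (hb : Bireg G p q) [Nonempty V] : n + 2 = 3 ∨ n + 2 = 4 := by
  obtain ⟨κ, hκ, H⟩ := GP.even_core n h hn p q hp hq hb
  have hpq : 0 < p * q := by positivity
  set y : ℝ := 2 * √((p*q : ℕ) : ℝ) * Real.cos (Real.pi / (n+2)) with hy
  obtain ⟨h1, h2, μ, h3⟩ := H 1 (by omega) (by omega) y (by rw [hy, Nat.cast_one, mul_one])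
  obtain ⟨r, hr⟩ := even_rat p q n μ κ (by omega) (by omega) hκ y hy h1 h2 h3
  have h4 := sq_rat_cases (p*q) (n+2) hpq (by omega) y (by rw [hy]; push_cast; rfl)
    ⟨r^2, by rw [hr]; push_cast; rfl⟩
  rcases h4 with h4 | h4 | h4 | h4
  · omega
  · exact Or.inl h4
  · exact Or.inr h4
  · exfalso
    obtain rfl : n = 4 := by omega
    obtain ⟨-, -, ν, h5⟩ := H 2 (by omega) (by omega) (√((p*q : ℕ) : ℝ)) (by
      rw [show Real.pi * (2:ℕ) / ((4:ℕ)+2) = Real.pi / 3 by push_cast; ring, Real.cos_pi_div_three]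
      ring)
    obtain ⟨r', hr'⟩ := even_twelve p q ν κ (by omega) (by omega) hκ _ rfl (by exact_mod_cast h5)
    have hpos : 0 < √((p*q : ℕ) : ℝ) := by positivity
    have hirr := Nat.Prime.irrational_sqrt Nat.prime_three
    apply hirr
    refine ⟨r / r', ?_⟩
    rw [show Real.pi / ((4:ℕ)+2) = Real.pi / 6 by push_cast; ring, Real.cos_pi_div_six] at hy
    push_cast
    rw [← hr, ← hr', hy]
    field_simp

end final

/-- Feit–Higman: a finite thick generalized `m`-gon satisfies
`m ∈ {2, 3, 4, 6, 8}`. -/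
theorem feit_higman
    (G : SimpleGraph V) [Fintype V]
    (m : ℕ) (hm : 2 ≤ m) (hG : IsGenPolygon G m) (hthick : Thick G) :
    m = 2 ∨ m = 3 ∨ m = 4 ∨ m = 6 ∨ m = 8 := by
  classical
  have h := GP.of G m hG hthick
  obtain ⟨u, v, huv⟩ := hG.2.2.2.1
  haveI : Nonempty V := ⟨u⟩
  obtain ⟨p, q, hp, hq, hb⟩ := h.biregular hm
  by_cases hm4 : m ≤ 4
  · omega
  rcases Nat.even_or_odd' m with ⟨k, rfl | hk⟩
  · obtain ⟨n, rfl⟩ := Nat.exists_eq_add_of_le' (show 2 ≤ k by omega)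
    have := GP.even_case n h (by omega) p q hp hq hb
    omega
  · have h1 := (h.parity (p + q + 2)
      (fun x y hxy => by rcases hb x y hxy with h1 | h1 <;> omega) m u v huv).2 (by omega)
    have h2 := h.opp_deg_eq hm huv
    have h3 := h.deg_cases hb u
    obtain rfl : p = q := by omega
    have := h.regular (by omega) p hp hb
    omega
end

section
/- Let L be a finite thick generalized 8-gon with parameters (s, t). Then s ≠ t; that is, the common degree of the vertices of one type is different from the common degree of the vertices of the other type. -/
open SimpleGraph

variable {V : Type*}

lemma oct_path_eq_of_short {G : SimpleGraph V} {u v : V} (p q : G.Walk u v) (hp : p.IsPath)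
    (hq : q.IsPath) (h : ((p.length + q.length : ℕ) : ℕ∞) < G.egirth) : p = q := by
  classical
  set H : SimpleGraph V := SimpleGraph.fromEdgeSet {e | e ∈ p.edges ∨ e ∈ q.edges} with hH
  have hle : H ≤ G := by
    intro a b hab
    rw [hH, SimpleGraph.fromEdgeSet_adj] at hab
    rcases hab.1 with h1 | h1
    · exact p.adj_of_mem_edges h1
    · exact q.adj_of_mem_edges h1
  have key : ∀ e ∈ H.edgeSet, e ∈ p.edges ∨ e ∈ q.edges := by
    intro e he
    rw [hH, SimpleGraph.edgeSet_fromEdgeSet] at he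
    exact he.1
  have hpH : ∀ e ∈ p.edges, e ∈ H.edgeSet := by
    intro e he
    rw [hH, SimpleGraph.edgeSet_fromEdgeSet]
    exact ⟨Or.inl he, G.not_isDiag_of_mem_edgeSet (p.edges_subset_edgeSet he)⟩
  have hqH : ∀ e ∈ q.edges, e ∈ H.edgeSet := by
    intro e he
    rw [hH, SimpleGraph.edgeSet_fromEdgeSet]
    exact ⟨Or.inr he, G.not_isDiag_of_mem_edgeSet (q.edges_subset_edgeSet he)⟩
  have hac : H.IsAcyclic := by
    by_contra hn
    obtain ⟨a, w, hw, hwl⟩ := SimpleGraph.exists_egirth_eq_length.mpr hn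
    have h1 : w.edges.length ≤ (p.edges ++ q.edges).length := by
      apply List.Subperm.length_le
      apply List.subperm_of_subset hw.isCircuit.isTrail.edges_nodup
      intro e he
      simpa using key e (w.edges_subset_edgeSet he)
    simp only [List.length_append, SimpleGraph.Walk.length_edges] at h1
    have h2 : G.egirth ≤ H.egirth := SimpleGraph.egirth_anti hle
    rw [hwl] at h2
    have h3 : (w.length : ℕ∞) ≤ ((p.length + q.length : ℕ) : ℕ∞) := by exact_mod_cast h1
    exact absurd h (not_lt.mpr (h2.trans h3))
  have := (hac.subsingleton_path u v).elim ⟨p.transfer H hpH, hp.transfer hpH⟩ ⟨q.transfer H hqH, hq.transfer hqH⟩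
  have h4 : (p.transfer H hpH).support = (q.transfer H hqH).support := by
    rw [Subtype.ext_iff] at this
    exact congrArg _ this
  rw [SimpleGraph.Walk.support_transfer, SimpleGraph.Walk.support_transfer] at h4
  exact SimpleGraph.Walk.ext_support h4

lemma oct_closer_unique {G : SimpleGraph V} (hconn : G.Connected) {u v w₁ w₂ : V} {k : ℕ}
    (hv : G.dist v u = k + 1) (a₁ : G.Adj v w₁) (a₂ : G.Adj v w₂)
    (h₁ : G.dist w₁ u = k) (h₂ : G.dist w₂ u = k)
    (hg : ((2 * k + 2 : ℕ) : ℕ∞) < G.egirth) : w₁ = w₂ := by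
  obtain ⟨p, hp⟩ := hconn.exists_walk_length_eq_dist w₁ u
  obtain ⟨q, hq⟩ := hconn.exists_walk_length_eq_dist w₂ u
  have e : SimpleGraph.Walk.cons a₁ p = SimpleGraph.Walk.cons a₂ q := by
    apply oct_path_eq_of_short
    · apply SimpleGraph.Walk.isPath_of_length_eq_dist
      simp [hp, h₁, hv]
    · apply SimpleGraph.Walk.isPath_of_length_eq_dist
      simp [hq, h₂, hv]
    · convert hg using 2
      simp [hp, hq, h₁, h₂]; ring
  simpa using congrArg SimpleGraph.Walk.snd e

lemma oct_closer_exists {G : SimpleGraph V} (hconn : G.Connected) {u v : V} {k : ℕ}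
    (hv : G.dist v u = k + 1) : ∃ w, G.Adj v w ∧ G.dist w u = k := by
  obtain ⟨p, hp⟩ := hconn.exists_walk_length_eq_dist v u
  cases p with
  | nil => simp at hv
  | cons h p =>
    rename_i w
    refine ⟨w, h, ?_⟩
    have h1 := SimpleGraph.dist_le p
    have h2 := hconn.dist_triangle (u := v) (v := w) (w := u)
    rw [SimpleGraph.dist_eq_one_iff_adj.mpr h] at h2
    simp at hp
    omega

lemma oct_dist_ne {G : SimpleGraph V} (hconn : G.Connected)
    (c : V → Bool) (hc : ∀ ⦃v w : V⦄, G.Adj v w → c v ≠ c w) {u v w : V} (h : G.Adj v w) :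
    G.dist v u ≠ G.dist w u := by
  intro he
  obtain ⟨p, hp⟩ := hconn.exists_walk_length_eq_dist v u
  obtain ⟨q, hq⟩ := hconn.exists_walk_length_eq_dist w u
  let C : G.Coloring Bool := SimpleGraph.Coloring.mk c (fun {a b} hab => hc hab)
  have h1 := C.even_length_iff_congr p
  have h2 := C.even_length_iff_congr q
  rw [hp, he, ← hq, h2] at h1
  have h3 := hc h
  change (c w ↔ c u) ↔ (c v ↔ c u) at h1
  revert h1 h3
  cases c v <;> cases c w <;> cases c u <;> simp

/-- One-step operator on functions of the distance. -/
noncomputable def octT (q : ℝ) (g : ℕ → ℝ) (j : ℕ) : ℝ :=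
  if j = 0 then (q + 1) * g 1 else if j = 8 then (q + 1) * g 7 else g (j - 1) + q * g (j + 1)

/-- Matrix whose entries are a function of the distance. -/
noncomputable def octM (G : SimpleGraph V) (g : ℕ → ℝ) : Matrix V V ℝ :=
  Matrix.of fun v u => g (G.dist v u)

lemma oct_sum (G : SimpleGraph V) [Fintype V] [DecidableRel G.Adj]
    (hconn : G.Connected) (hd : ∀ u v : V, G.dist u v ≤ 8) (hg : G.egirth = ((16 : ℕ) : ℕ∞))
    (c : V → Bool) (hc : ∀ ⦃v w : V⦄, G.Adj v w → c v ≠ c w)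
    (s : ℕ) (hs : ∀ v : V, G.degree v = s + 1) (g : ℕ → ℝ) (v u : V) :
    ∑ w ∈ G.neighborFinset v, g (G.dist w u) = octT s g (G.dist v u) := by
  classical
  have hstep : ∀ w, G.Adj v w → G.dist w u = G.dist v u + 1 ∨ G.dist w u + 1 = G.dist v u := by
    intro w h
    have h1 := oct_dist_ne hconn c hc (u := u) h
    have h2 := hconn.dist_triangle (u := v) (v := w) (w := u)
    have h3 := hconn.dist_triangle (u := w) (v := v) (w := u)
    rw [SimpleGraph.dist_eq_one_iff_adj.mpr h] at h2
    rw [SimpleGraph.dist_eq_one_iff_adj.mpr h.symm] at h3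
    omega
  have hcard : (G.neighborFinset v).card = s + 1 := by rw [G.card_neighborFinset_eq_degree, hs]
  have hall : ∀ k, (∀ w, G.Adj v w → G.dist w u = k) →
      ∑ w ∈ G.neighborFinset v, g (G.dist w u) = (s + 1) * g k := by
    intro k hk
    rw [Finset.sum_congr rfl (g := fun _ => g k)]
    · rw [Finset.sum_const, hcard]; simp
    · intro w hw
      rw [hk w (by simpa using hw)]
  unfold octT
  split_ifs with h0 h8
  · apply hall
    intro w hw
    have := hstep w hw
    omega
  · apply hall
    intro w hw
    have := hstep w hw
    have := hd w u
    omega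
  · obtain ⟨k, hk⟩ := Nat.exists_eq_succ_of_ne_zero h0
    have hd' := hd v u
    obtain ⟨w₀, ha, hw₀⟩ := oct_closer_exists hconn hk
    have hmem : w₀ ∈ G.neighborFinset v := by simpa using ha
    rw [← Finset.add_sum_erase _ _ hmem]
    have hrest : ∑ w ∈ (G.neighborFinset v).erase w₀, g (G.dist w u)
        = ∑ w ∈ (G.neighborFinset v).erase w₀, g (G.dist v u + 1) := by
      apply Finset.sum_congr rfl
      intro w hw
      rw [Finset.mem_erase, SimpleGraph.mem_neighborFinset] at hw
      rcases hstep w hw.2 with h | h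
      · rw [h]
      · exfalso
        apply hw.1
        apply oct_closer_unique hconn hk hw.2 ha (by omega) hw₀
        rw [hg]
        exact_mod_cast (by omega : 2 * k + 2 < 16)
    rw [hrest, Finset.sum_const, Finset.card_erase_of_mem hmem, hcard, hw₀, hk]
    simp

lemma oct_adj_mul (G : SimpleGraph V) [Fintype V] [DecidableRel G.Adj]
    (hconn : G.Connected) (hd : ∀ u v : V, G.dist u v ≤ 8) (hg : G.egirth = ((16 : ℕ) : ℕ∞))
    (c : V → Bool) (hc : ∀ ⦃v w : V⦄, G.Adj v w → c v ≠ c w)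
    (s : ℕ) (hs : ∀ v : V, G.degree v = s + 1) (g : ℕ → ℝ) :
    G.adjMatrix ℝ * octM G g = octM G (octT s g) := by
  ext v u
  rw [SimpleGraph.adjMatrix_mul_apply]
  exact oct_sum G hconn hd hg c hc s hs g v u

lemma octM_congr (G : SimpleGraph V) (hd : ∀ u v : V, G.dist u v ≤ 8) {g h : ℕ → ℝ}
    (e : ∀ j ≤ 8, g j = h j) : octM G g = octM G h := by
  ext v u
  exact e _ (hd v u)

lemma octM_add (G : SimpleGraph V) (g h : ℕ → ℝ) : octM G g + octM G h = octM G (g + h) := rfl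

lemma octM_smul (G : SimpleGraph V) (a : ℝ) (g : ℕ → ℝ) : a • octM G g = octM G (a • g) := rfl

lemma oct_trace_idem [Fintype V] [DecidableEq V] (P : Matrix V V ℝ) (h : P * P = P) :
    ∃ m : ℕ, P.trace = m := by
  have hi : IsIdempotentElem (Matrix.toLin' P) := by
    unfold IsIdempotentElem
    rw [Module.End.mul_eq_comp, ← Matrix.toLin'_mul, h]
  obtain ⟨p, hp⟩ := (LinearMap.isProj_iff_isIdempotentElem _).mpr hi
  exact ⟨Module.finrank ℝ p, by rw [← hp.trace, Matrix.trace_toLin'_eq]⟩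

/-- Delta function. -/
noncomputable def octD (k : ℕ) (j : ℕ) : ℝ := if j = k then 1 else 0

lemma oct_main (G : SimpleGraph V) [Fintype V] [DecidableRel G.Adj]
    (hconn : G.Connected) (hd : ∀ u v : V, G.dist u v ≤ 8) (hg : G.egirth = ((16 : ℕ) : ℕ∞))
    (hthick : Thick G)
    (c : V → Bool) (hc : ∀ ⦃v w : V⦄, G.Adj v w → c v ≠ c w)
    (s : ℕ) (hs : ∀ v : V, G.degree v = s + 1) : False := by
  classical
  obtain ⟨v₀⟩ := hconn.nonempty
  have hs2 : 2 ≤ s := by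
    obtain ⟨x, y, z, hx, hy, hz, hxy, hxz, hyz⟩ := hthick v₀
    have h1 : ({x, y, z} : Finset V) ⊆ G.neighborFinset v₀ := by
      intro w hw
      simp only [Finset.mem_insert, Finset.mem_singleton] at hw
      rcases hw with rfl | rfl | rfl <;> simpa
    have h2 := Finset.card_le_card h1
    rw [G.card_neighborFinset_eq_degree, hs, Finset.card_eq_three.mpr ⟨x, y, z, hxy, hxz, hyz, rfl⟩]
      at h2
    omega
  have hmul := oct_adj_mul G hconn hd hg c hc s hs
  set A := G.adjMatrix ℝ with hA
  have hq : (2 : ℝ) ≤ s := by exact_mod_cast hs2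
  set q : ℝ := (s : ℝ) with hqdef
  have hq0 : q ≠ 0 := by positivity
  have hq1 : q + 1 ≠ 0 := by positivity
  set D : ℕ → Matrix V V ℝ := fun k => octM G (octD k) with hD
  have D0 : D 0 = 1 := by
    ext v u
    simp only [hD, octM, octD, Matrix.of_apply, Matrix.one_apply, hconn.dist_eq_zero_iff]
  have R0 : A * A = (q + 1) • (1 : Matrix V V ℝ) + D 2 := by
    have : A * (A * D 0) = (q + 1) • D 0 + D 2 := by
      simp only [hD, hmul, octM_add, octM_smul]
      apply octM_congr G hd
      intro j hj
      interval_cases j <;> simp [octT, octD]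
    rwa [D0, mul_one] at this
  have R2 : A * A * D 2 = D 4 + (2 * q) • D 2 + (q * (q + 1)) • 1 := by
    rw [← D0, mul_assoc]
    simp only [hD, hmul, octM_add, octM_smul]
    apply octM_congr G hd
    intro j hj
    interval_cases j <;> simp [octT, octD] <;> ring
  have R4 : A * A * D 4 = D 6 + (2 * q) • D 4 + (q ^ 2) • D 2 := by
    rw [mul_assoc]
    simp only [hD, hmul, octM_add, octM_smul]
    apply octM_congr G hd
    intro j hj
    interval_cases j <;> simp [octT, octD] <;> ring
  have R6 : A * A * D 6 = (q + 1) • D 8 + (2 * q) • D 6 + (q ^ 2) • D 4 := by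
    rw [mul_assoc]
    simp only [hD, hmul, octM_add, octM_smul]
    apply octM_congr G hd
    intro j hj
    interval_cases j <;> simp [octT, octD] <;> ring
  have R8 : A * A * D 8 = (q * (q + 1)) • D 8 + (q ^ 2) • D 6 := by
    rw [mul_assoc]
    simp only [hD, hmul, octM_add, octM_smul]
    apply octM_congr G hd
    intro j hj
    interval_cases j <;> simp [octT, octD] <;> ring
  obtain ⟨r, hr⟩ : ∃ r : ℝ, r = √2 := ⟨_, rfl⟩
  have hr2 : r ^ 2 = 2 := by rw [hr]; norm_num
  have hirr : Irrational r := hr ▸ irrational_sqrt_two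
  obtain ⟨y, hy⟩ : ∃ y : ℝ, y * (q + 1) = q - 1 + q * r := ⟨(q - 1 + q * r) / (q + 1), by field_simp⟩
  -- the eigenvalue and the cosine sequence
  set μ : ℝ := q * (2 + r) with hμ
  obtain ⟨x1, hx1⟩ : ∃ x : ℝ, x * q = y := ⟨y / q, by field_simp⟩
  obtain ⟨x2, hx2⟩ : ∃ x : ℝ, x * q ^ 2 = r * y - 1 := ⟨(r * y - 1) / q ^ 2, by field_simp⟩
  obtain ⟨x3, hx3⟩ : ∃ x : ℝ, x * q ^ 3 = y - r := ⟨(y - r) / q ^ 3, by field_simp⟩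
  obtain ⟨x4, hx4⟩ : ∃ x : ℝ, x * q ^ 4 = -1 := ⟨-1 / q ^ 4, by field_simp⟩
  set F : Matrix V V ℝ := 1 + x1 • D 2 + x2 • D 4 + x3 • D 6 + x4 • D 8 with hF
  have c0 : (q + 1) + x1 * (q * (q + 1)) = μ := by
    linear_combination (q + 1) * hx1 + hy
  have c2 : 1 + x1 * (2 * q) + x2 * q ^ 2 = μ * x1 := by
    linear_combination hx2 - r * hx1
  have c4 : x1 + x2 * (2 * q) + x3 * q ^ 2 = μ * x2 := by
    apply mul_right_cancel₀ hq0
    linear_combination hx1 + hx3 - r * hx2 - hr2 * y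
  have c6 : x2 + x3 * (2 * q) + x4 * q ^ 2 = μ * x3 := by
    apply mul_right_cancel₀ (pow_ne_zero 2 hq0)
    linear_combination hx2 + hx4 - r * hx3 + hr2
  have c8 : x3 * (q + 1) + x4 * (q * (q + 1)) = μ * x4 := by
    apply mul_right_cancel₀ (pow_ne_zero 3 hq0)
    linear_combination (q + 1) * hx3 + hx4 * (q - 1 - r) + hy
  have hAF : A * A * F = μ • F := by
    have : A * A * F = A * A + x1 • (A * A * D 2) + x2 • (A * A * D 4) + x3 • (A * A * D 6)
        + x4 • (A * A * D 8) := by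
      simp only [hF, mul_add, mul_one, Matrix.mul_smul]
    rw [this, R2, R4, R6, R8, R0, hF]
    ext a b
    simp only [Matrix.add_apply, Matrix.smul_apply, smul_eq_mul]
    linear_combination (1 : Matrix V V ℝ) a b * c0 + D 2 a b * c2 + D 4 a b * c4
      + D 6 a b * c6 + D 8 a b * c8
  have comb : ∀ {X Y : Matrix V V ℝ} {a : ℝ}, X = Y → X * F = Y * F := fun h => by rw [h]
  obtain ⟨v1, hv1⟩ : ∃ v : ℝ, v = μ - (q + 1) := ⟨_, rfl⟩
  obtain ⟨v2, hv2⟩ : ∃ v : ℝ, v = (μ - 2 * q) * v1 - q * (q + 1) := ⟨_, rfl⟩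
  obtain ⟨v3, hv3⟩ : ∃ v : ℝ, v = (μ - 2 * q) * v2 - q ^ 2 * v1 := ⟨_, rfl⟩
  obtain ⟨v4, hv4⟩ : ∃ v : ℝ, v * (q + 1) = (μ - 2 * q) * v3 - q ^ 2 * v2 :=
    ⟨((μ - 2 * q) * v3 - q ^ 2 * v2) / (q + 1), by field_simp⟩
  have F2 : D 2 * F = v1 • F := by
    have h := congrArg (· * F) R0
    simp only [hAF, add_mul, Matrix.smul_mul, one_mul] at h
    rw [hv1, sub_smul, h]; abel
  have hcomm : ∀ k (v : ℝ), D k * F = v • F → A * A * D k * F = (v * μ) • F := by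
    intro k v h
    rw [mul_assoc (A * A), h, Matrix.mul_smul, hAF, smul_smul]
  have F4 : D 4 * F = v2 • F := by
    have h := congrArg (· * F) R2
    simp only [hcomm 2 v1 F2, add_mul, Matrix.smul_mul, one_mul, F2, smul_smul] at h
    ext a b
    have h' := congrFun (congrFun h a) b
    simp only [Matrix.add_apply, Matrix.smul_apply, smul_eq_mul] at h' ⊢
    rw [hv2]; linear_combination -h'
  have F6 : D 6 * F = v3 • F := by
    have h := congrArg (· * F) R4
    simp only [hcomm 4 v2 F4, add_mul, Matrix.smul_mul, one_mul, F2, F4, smul_smul] at h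
    ext a b
    have h' := congrFun (congrFun h a) b
    simp only [Matrix.add_apply, Matrix.smul_apply, smul_eq_mul] at h' ⊢
    rw [hv3]; linear_combination -h'
  have F8 : D 8 * F = v4 • F := by
    have h := congrArg (· * F) R6
    simp only [hcomm 6 v3 F6, add_mul, Matrix.smul_mul, one_mul, F4, F6, smul_smul] at h
    ext a b
    have h' := congrFun (congrFun h a) b
    simp only [Matrix.add_apply, Matrix.smul_apply, smul_eq_mul] at h' ⊢
    apply mul_left_cancel₀ hq1
    linear_combination -h' - F a b * hv4
  obtain ⟨l, hl⟩ : ∃ l : ℝ, l = 1 + x1 * v1 + x2 * v2 + x3 * v3 + x4 * v4 := ⟨_, rfl⟩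
  have FF : F * F = l • F := by
    have : F * F = F + x1 • (D 2 * F) + x2 • (D 4 * F) + x3 • (D 6 * F) + x4 • (D 8 * F) := by
      nth_rewrite 1 [hF]
      simp only [add_mul, one_mul, Matrix.smul_mul]
    rw [this, F2, F4, F6, F8, hl]
    simp only [smul_smul, add_smul, one_smul]
  -- value of `l`
  have e1 : v1 = (q + 1) * y := by rw [hv1, hμ]; linear_combination -hy
  have e2 : v2 = q * (q + 1) * (r * y - 1) := by rw [hv2, e1, hμ]; ring
  have e3 : v3 = q ^ 2 * (q + 1) * (y - r) := by
    rw [hv3, e2, e1, hμ]; linear_combination q ^ 2 * (q + 1) * y * hr2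
  have e4 : v4 = -q ^ 3 := by
    apply mul_right_cancel₀ hq1
    rw [hv4, e3, e2, hμ]; linear_combination - q ^ 3 * (q + 1) * hr2
  have hl2 : l * (q * (q + 1)) = 4 * (2 * (q ^ 2 - q + 1) + r * (q - 1) ^ 2) := by
    have h : l * q = 4 * (q + 1) * (y ^ 2 - r * y + 1) := by
      rw [hl, e1, e2, e3, e4]
      linear_combination (q + 1) * y * hx1 + (q + 1) * (r * y - 1) * hx2 + (q + 1) * (y - r) * hx3
        - hx4 + (q + 1) * (y ^ 2 + 1) * hr2
    apply mul_right_cancel₀ hq1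
    linear_combination (q + 1) ^ 2 * h + 4 * (q + 1) * (y * (q + 1) + (q - 1 + q * r)
      - r * (q + 1)) * hy - 4 * (q + 1) * q * hr2
  have hr0 : 0 < r := by rw [hr]; positivity
  have hl0 : l ≠ 0 := by
    rintro rfl
    have : 0 < 4 * (2 * (q ^ 2 - q + 1) + r * (q - 1) ^ 2) := by
      have : 0 < q ^ 2 - q + 1 := by nlinarith
      positivity
    rw [← hl2] at this
    simp at this
  obtain ⟨m, hm⟩ := oct_trace_idem (l⁻¹ • F) (by
    rw [Matrix.smul_mul, Matrix.mul_smul, FF, smul_smul, smul_smul]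
    congr 1
    field_simp)
  have trD : ∀ k, k ≠ 0 → (D k).trace = 0 := by
    intro k hk
    simp [Matrix.trace, hD, octM, octD, hk.symm]
  have trF : F.trace = Fintype.card V := by
    simp [hF, Matrix.trace_add, Matrix.trace_smul, trD, Matrix.trace_one]
  rw [Matrix.trace_smul, trF, smul_eq_mul] at hm
  have hn : (Fintype.card V : ℝ) = l * m := by rw [← hm]; field_simp
  have hnpos : 0 < Fintype.card V := Fintype.card_pos_iff.mpr ⟨v₀⟩
  have hm0 : m ≠ 0 := by
    rintro rfl
    simp at hn
    omega
  have hm0' : (m : ℝ) ≠ 0 := by exact_mod_cast hm0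
  have hq10 : (q - 1) ≠ 0 := by linarith
  apply hirr
  refine ⟨((Fintype.card V : ℚ) * (s * (s + 1)) / (4 * m) - 2 * ((s : ℚ) ^ 2 - s + 1)) / ((s : ℚ) - 1) ^ 2, ?_⟩
  push_cast
  rw [← hqdef, hn]
  rw [div_eq_iff (pow_ne_zero 2 hq10), sub_eq_iff_eq_add, div_eq_iff (by positivity)]
  linear_combination m * hl2

/-- A finite thick generalized `8`-gon with parameters `(s, t)` satisfies `s ≠ t`:
the common degree of the vertices of one type differs from that of the other
type. -/
theorem octagon_parameters_ne
    (G : SimpleGraph V) [Fintype V] [DecidableRel G.Adj]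
    (hG : IsGenPolygon G 8) (hthick : Thick G)
    (c : V → Bool) (hc : ∀ ⦃v w : V⦄, G.Adj v w → c v ≠ c w)
    (s t : ℕ)
    (hs : ∀ v : V, c v = false → G.degree v = s + 1)
    (ht : ∀ v : V, c v = true → G.degree v = t + 1) :
    s ≠ t := by
  rintro rfl
  obtain ⟨hconn, -, hd, -, hg⟩ := hG
  have hdeg : ∀ v : V, G.degree v = s + 1 := by
    intro v
    rcases hv : c v with _ | _
    · exact hs v hv
    · exact ht v hv
  exact oct_main G hconn hd (by rw [hg]; norm_num) hthick c hc s hdeg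
end
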